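/- arXiv:math/0010237 — 2 statements merged into one kernel-verified Lean document; each statement's English description precedes it below -/
import Mathlib

section
/- Let (M, s) be an oriented Lagrangian matroid with fundamental basis F, and let P be its matroid polytope with the corresponding orientation of short edges. Then the index of M relative to F equals the number of inducing edges (relative to F) contained in any path of edges of P from F to a basis of maximal height relative to F in which no edge is traversed downwards relative to F (i.e. the height never decreases along the path). -/
open Finset Matrix
open scoped Classical

/-- The index set `J = I ∪ I*`: the element `(i, false)` represents the unstarred
index `i+1`, and `(i, true)` represents the starred index `(i+1)*`. -/
abbrev JJ (n : ℕ) := Fin n × Bool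

/-- The involution `* : J → J`. -/
def starJ {n : ℕ} (x : JJ n) : JJ n := (x.1, !x.2)

/-- A subset `A ⊆ J` is admissible iff `A ∩ A* = ∅`. -/
def AdmissibleSet {n : ℕ} (A : Finset (JJ n)) : Prop := ∀ x ∈ A, starJ x ∉ A

/-- An admissible permutation of `J`: one commuting with `*`.  These form the
hyperoctahedral group `W = BC_n`. -/
def AdmissiblePerm {n : ℕ} (w : Equiv.Perm (JJ n)) : Prop := ∀ x, w (starJ x) = starJ (w x)

/-- The standard ordering `n* < … < 1* < 1 < … < n` on `J`, encoded by a value in `ℤ`. -/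
def ordJ {n : ℕ} (x : JJ n) : ℤ := if x.2 then -((x.1 : ℤ) + 1) else (x.1 : ℤ) + 1

/-- The ordering `≤^w` on `J`: `x ≤^w y` iff `w⁻¹ x ≤ w⁻¹ y` in the standard order. -/
def leW {n : ℕ} (w : Equiv.Perm (JJ n)) (x y : JJ n) : Prop :=
  ordJ (w.symm x) ≤ ordJ (w.symm y)

/-- The (Gale) ordering induced by `≤^w` on admissible subsets: `A ≼^w B` iff the
sorted lists dominate componentwise, equivalently iff there is a bijection
`f : A → B` with `a ≤^w f a` for all `a ∈ A`. -/
def setLE {n : ℕ} (w : Equiv.Perm (JJ n)) (A B : Finset (JJ n)) : Prop :=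
  ∃ f : JJ n → JJ n, Set.BijOn f ↑A ↑B ∧ ∀ a ∈ A, leW w a (f a)

/-- `ℬ` is the collection of bases of a symplectic matroid of rank `k`: all members
are admissible `k`-sets, and for every admissible permutation `w` there is a
(necessarily unique) `≤^w`-maximal member (the Maximality Property). -/
def IsSymplecticMatroid {n : ℕ} (k : ℕ) (ℬ : Finset (Finset (JJ n))) : Prop :=
  (∀ A ∈ ℬ, AdmissibleSet A ∧ A.card = k) ∧
  ∀ w : Equiv.Perm (JJ n), AdmissiblePerm w → ∃ A ∈ ℬ, ∀ B ∈ ℬ, setLE w B A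

/-- A Lagrangian matroid is a symplectic matroid of rank `n`. -/
def IsLagrangianMatroid {n : ℕ} (ℬ : Finset (Finset (JJ n))) : Prop :=
  IsSymplecticMatroid n ℬ
/-- The vector `e_j ∈ ℝ^n` for `j ∈ J`: `e_i` for unstarred `i`, `-e_i` for starred. -/
def eVec {n : ℕ} (x : JJ n) : Fin n → ℝ :=
  fun i => if i = x.1 then (if x.2 then -1 else 1) else 0

/-- The point `e_A = Σ_{j ∈ A} e_j ∈ ℝ^n` associated to an admissible set `A`. -/
def eSet {n : ℕ} (A : Finset (JJ n)) : Fin n → ℝ := ∑ x ∈ A, eVec x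

/-- The matroid polytope: the convex hull of the points `e_A`, `A ∈ ℬ`. -/
def matroidPolytope {n : ℕ} (ℬ : Finset (Finset (JJ n))) : Set (Fin n → ℝ) :=
  convexHull ℝ (eSet '' ↑ℬ)

/-- Bases `A` and `B` are joined by an edge of the matroid polytope: there is a linear
functional taking equal maximal values at `e_A`, `e_B` and strictly smaller values at
all other vertices. -/
def IsEdge {n : ℕ} (ℬ : Finset (Finset (JJ n))) (A B : Finset (JJ n)) : Prop :=
  A ∈ ℬ ∧ B ∈ ℬ ∧ A ≠ B ∧
  ∃ L : (Fin n → ℝ) →ₗ[ℝ] ℝ, L (eSet A) = L (eSet B) ∧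
    ∀ C ∈ ℬ, C ≠ A → C ≠ B → L (eSet C) < L (eSet A)

/-- The height of `A` relative to the fundamental basis `F`: `h(A) = n - |A ∩ F|`. -/
def heightF {n : ℕ} (F A : Finset (JJ n)) : ℕ := n - (A ∩ F).card

/-- A short edge: an edge whose ends are related by a short exchange `A = B ∆ {i,i*}`. -/
def IsShortEdge {n : ℕ} (ℬ : Finset (Finset (JJ n))) (A B : Finset (JJ n)) : Prop :=
  IsEdge ℬ A B ∧ ∃ i : JJ n, symmDiff A B = ({i, starJ i} : Finset (JJ n))

/-- A long edge: an edge whose ends are related by a long exchange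
`A = B ∆ {i,i*,j,j*}`, `i ∉ {j,j*}`. -/
def IsLongEdge {n : ℕ} (ℬ : Finset (Finset (JJ n))) (A B : Finset (JJ n)) : Prop :=
  IsEdge ℬ A B ∧ ∃ i j : JJ n, i ≠ j ∧ i ≠ starJ j ∧
    symmDiff A B = ({i, starJ i, j, starJ j} : Finset (JJ n))

/-- The four bases of a 2-dimensional face of the matroid polytope which is a square
with short edges (type sSquare): `A`, `A ∆ {i,i*}`, `A ∆ {j,j*}`, `A ∆ {i,i*,j,j*}`,
all of them bases. -/
def ShortSquare {n : ℕ} (ℬ : Finset (Finset (JJ n))) (v : Fin 4 → Finset (JJ n)) : Prop :=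
  ∃ (A : Finset (JJ n)) (i j : JJ n), i.1 ≠ j.1 ∧
    v 0 = A ∧ v 1 = symmDiff A ({i, starJ i} : Finset (JJ n)) ∧
    v 2 = symmDiff A ({j, starJ j} : Finset (JJ n)) ∧
    v 3 = symmDiff A ({i, starJ i, j, starJ j} : Finset (JJ n)) ∧
    ∀ k : Fin 4, v k ∈ ℬ

/-- `sF` is an orientation of the Lagrangian matroid with bases `ℬ` relative to the
fundamental basis `F`: it takes values `±1` on bases and satisfies axioms (i)–(iv). -/
def IsOrientationRel {n : ℕ} (ℬ : Finset (Finset (JJ n))) (F : Finset (JJ n))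
    (sF : Finset (JJ n) → ℤ) : Prop :=
  (∀ A ∈ ℬ, sF A = 1 ∨ sF A = -1) ∧
  (∀ A B : Finset (JJ n), IsLongEdge ℬ A B → heightF F A = heightF F B → sF A = sF B) ∧
  (∀ A B : Finset (JJ n), IsLongEdge ℬ A B → heightF F A ≠ heightF F B → sF A = -sF B) ∧
  (∀ v : Fin 4 → Finset (JJ n), ShortSquare ℬ v →
    ∀ k : Fin 4,
      ((∀ l m : Fin 4, l ≠ k → m ≠ k → sF (v l) = sF (v m)) ∧
        ∃ l : Fin 4, l ≠ k ∧ sF (v l) ≠ sF (v k)) →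
      (∀ l : Fin 4, heightF F (v l) ≤ heightF F (v k)) ∨
      (∀ l : Fin 4, heightF F (v k) ≤ heightF F (v l))) ∧
  sF F = 1

/-- `(ℬ, s)` is an oriented Lagrangian matroid: `s` vanishes when an argument is not a
basis, each `s G` is an orientation relative to `G`, and the change-of-fundamental-basis
rule holds. -/
def IsOrientation {n : ℕ} (ℬ : Finset (Finset (JJ n)))
    (s : Finset (JJ n) → Finset (JJ n) → ℤ) : Prop :=
  (∀ G A : Finset (JJ n), G ∉ ℬ ∨ A ∉ ℬ → s G A = 0) ∧
  (∀ G ∈ ℬ, IsOrientationRel ℬ G (s G)) ∧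
  (∀ G ∈ ℬ, ∀ H ∈ ℬ, ∀ A ∈ ℬ, s G A = s H A * s H G * (-1) ^ ((G \ (H ∪ A)).card))
/-- An increasing path of length `p` in the matroid polytope starting at the
fundamental basis `F`: consecutive vertices are joined by edges and strictly increase
for some linear functional compatible with the height relative to `F`. -/
def IncreasingPath {n : ℕ} (ℬ : Finset (Finset (JJ n))) (F : Finset (JJ n))
    (v : ℕ → Finset (JJ n)) (p : ℕ) : Prop :=
  v 0 = F ∧ (∀ i < p, IsEdge ℬ (v i) (v (i + 1))) ∧
  ∃ L : (Fin n → ℝ) →ₗ[ℝ] ℝ,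
    (∀ A ∈ ℬ, ∀ B ∈ ℬ, heightF F B < heightF F A → L (eSet B) < L (eSet A)) ∧
    ∀ i < p, L (eSet (v i)) < L (eSet (v (i + 1)))

/-- A height-increasing path: consecutive vertices are adjacent in the polytope and
the height relative to `F` strictly increases. -/
def HeightIncreasingPath {n : ℕ} (ℬ : Finset (Finset (JJ n))) (F : Finset (JJ n))
    (v : ℕ → Finset (JJ n)) (p : ℕ) : Prop :=
  v 0 = F ∧ ∀ i < p, IsEdge ℬ (v i) (v (i + 1)) ∧ heightF F (v i) < heightF F (v (i + 1))

/-- `A` is a basis of maximal height relative to `F`. -/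
def MaxHeightBasis {n : ℕ} (ℬ : Finset (Finset (JJ n))) (F A : Finset (JJ n)) : Prop :=
  A ∈ ℬ ∧ ∀ B ∈ ℬ, heightF F B ≤ heightF F A

/-- The number of changes of sign of `sF` along the path `v 0, v 1, …, v p`. -/
def signChanges {n : ℕ} (sF : Finset (JJ n) → ℤ) (v : ℕ → Finset (JJ n)) (p : ℕ) : ℕ :=
  ((Finset.range p).filter fun i => sF (v i) ≠ sF (v (i + 1))).card

/-- A 2-dimensional (exposed) face of the matroid polytope. -/
def Is2Face {n : ℕ} (ℬ : Finset (Finset (JJ n))) (Fc : Set (Fin n → ℝ)) : Prop :=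
  IsExposed ℝ (matroidPolytope ℬ) Fc ∧ Module.finrank ℝ (vectorSpan ℝ Fc) = 2

/-- `v 0, …, v (m-1)` is the cycle of vertices (bases) of the 2-dimensional face `Fc`
of the matroid polytope, consecutive ones (cyclically) being joined by edges. -/
def FaceCycle {n : ℕ} (ℬ : Finset (Finset (JJ n))) (Fc : Set (Fin n → ℝ)) (m : ℕ)
    (v : ℕ → Finset (JJ n)) : Prop :=
  Is2Face ℬ Fc ∧ 3 ≤ m ∧ (∀ i < m, v i ∈ ℬ ∧ eSet (v i) ∈ Fc) ∧
  (∀ A ∈ ℬ, eSet A ∈ Fc → ∃! i : ℕ, i < m ∧ v i = A) ∧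
  ∀ i < m, IsEdge ℬ (v i) (v ((i + 1) % m))

/-- An orientation of the Lagrangian matroid polytope: an assignment `ε` of directions
to short edges (`ε A B = 1` when the edge is directed from `A` to `B`; `ε` vanishes on
non-(short edges)) such that in every 2-dimensional face the number of short edges
directed clockwise equals the number directed anti-clockwise. -/
def IsPolytopeOrientation {n : ℕ} (ℬ : Finset (Finset (JJ n)))
    (ε : Finset (JJ n) → Finset (JJ n) → ℤ) : Prop :=
  (∀ A B : Finset (JJ n), IsShortEdge ℬ A B → (ε A B = 1 ∨ ε A B = -1) ∧ ε B A = -ε A B) ∧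
  (∀ A B : Finset (JJ n), ¬IsShortEdge ℬ A B → ε A B = 0) ∧
  ∀ (Fc : Set (Fin n → ℝ)) (m : ℕ) (v : ℕ → Finset (JJ n)), FaceCycle ℬ Fc m v →
    (∑ i ∈ Finset.range m, ε (v i) (v ((i + 1) % m))) = 0

/-- An inducing edge relative to `F`, for the polytope orientation `ε`: a vertical long
edge, or a short edge directed downwards (from the higher basis to the lower one). -/
def IsInducingEdge {n : ℕ} (ℬ : Finset (Finset (JJ n)))
    (ε : Finset (JJ n) → Finset (JJ n) → ℤ) (F A B : Finset (JJ n)) : Prop :=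
  (IsLongEdge ℬ A B ∧ heightF F A ≠ heightF F B) ∨
  (IsShortEdge ℬ A B ∧
    ((heightF F B < heightF F A ∧ ε A B = 1) ∨ (heightF F A < heightF F B ∧ ε B A = 1)))

/-- The signs `s` are induced from the polytope orientation `ε`: for every fundamental
basis `F`, `s F F = 1`, bases joined by an inducing edge get opposite signs, and bases
joined by a non-inducing edge get the same sign. -/
def InducedBy {n : ℕ} (ℬ : Finset (Finset (JJ n)))
    (ε : Finset (JJ n) → Finset (JJ n) → ℤ)
    (s : Finset (JJ n) → Finset (JJ n) → ℤ) : Prop :=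
  ∀ F ∈ ℬ, s F F = 1 ∧ ∀ A B : Finset (JJ n), IsEdge ℬ A B →
    (IsInducingEdge ℬ ε F A B → s F A = -s F B) ∧
    (¬IsInducingEdge ℬ ε F A B → s F A = s F B)

/-- An inducing edge relative to `F`, expressed directly through the orientation `s` of
the matroid (the corresponding polytope orientation directs a short edge from `A` to
`B` exactly when `s A B = +1`): a vertical long edge, or a short edge directed
downwards. -/
def IsInducingEdgeS {n : ℕ} (ℬ : Finset (Finset (JJ n)))
    (s : Finset (JJ n) → Finset (JJ n) → ℤ) (F A B : Finset (JJ n)) : Prop :=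
  (IsLongEdge ℬ A B ∧ heightF F A ≠ heightF F B) ∨
  (IsShortEdge ℬ A B ∧
    ((heightF F B < heightF F A ∧ s A B = 1) ∨ (heightF F A < heightF F B ∧ s B A = 1)))


section Comb
variable {n : ℕ}

/-- `W` lies in the interval spanned by `X` and `Y`. -/
def Intv (X Y W : Finset (Fin n)) : Prop := ∀ t, (t ∈ X ↔ t ∈ Y) → (t ∈ W ↔ t ∈ X)

/-- The pair `X, Y` can be split. -/
def SplitAt (Fe : Finset (Fin n) → Prop) (X Y : Finset (Fin n)) : Prop :=
  (∃ W, Fe W ∧ W ≠ X ∧ W ≠ Y ∧ Intv X Y W) ∧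
    ((symmDiff X Y).card = 2 → ∀ t ∈ symmDiff X Y, Fe (symmDiff X {t}))

lemma Intv.card_left {X Y W : Finset (Fin n)} (h : Intv X Y W) (hW : W ≠ Y) :
    (symmDiff X W).card < (symmDiff X Y).card := by
  apply Finset.card_lt_card
  refine Finset.ssubset_iff_subset_ne.2 ⟨?_, ?_⟩
  · intro t ht
    have := h t
    simp only [Finset.mem_symmDiff] at *
    tauto
  · intro he
    exact hW (symmDiff_right_injective X he)

lemma Intv.card_right {X Y W : Finset (Fin n)} (h : Intv X Y W) (hW : W ≠ X) :
    (symmDiff W Y).card < (symmDiff X Y).card := by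
  apply Finset.card_lt_card
  refine Finset.ssubset_iff_subset_ne.2 ⟨?_, ?_⟩
  · intro t ht
    have := h t
    simp only [Finset.mem_symmDiff] at *
    tauto
  · intro he
    exact hW (symmDiff_left_injective Y he)

/-- Path-sum between two feasible sets. -/
noncomputable def DD (Fe : Finset (Fin n) → Prop) (σ : Finset (Fin n) → ℤ)
    (X Y : Finset (Fin n)) : ℤ :=
  if h : SplitAt Fe X Y then
    DD Fe σ X h.1.choose + DD Fe σ h.1.choose Y
  else if (symmDiff X Y).card = 1 then σ X * σ Y * ((X.card : ℤ) - Y.card) else 0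
termination_by (symmDiff X Y).card
decreasing_by
  · exact h.1.choose_spec.2.2.2.card_left h.1.choose_spec.2.2.1
  · exact h.1.choose_spec.2.2.2.card_right h.1.choose_spec.2.1

/-- Abstract data: signed delta-matroid. -/
structure SDM (Fe : Finset (Fin n) → Prop) (σ : Finset (Fin n) → ℤ) : Prop where
  ex : ∀ X Y, Fe X → Fe Y → ∀ k ∈ symmDiff X Y, ∃ j ∈ symmDiff X Y, Fe (symmDiff X {k, j})
  pm : ∀ X, Fe X → σ X = 1 ∨ σ X = -1
  long : ∀ X i j, i ≠ j → Fe X → Fe (symmDiff X {i, j}) →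
    ¬ (Fe (symmDiff X {i}) ∧ Fe (symmDiff X {j})) →
    σ (symmDiff X {i, j}) = if (i ∈ X ↔ j ∈ X) then - σ X else σ X
  sq : ∀ X i j, i ≠ j → Fe X → Fe (symmDiff X {i, j}) → Fe (symmDiff X {i}) →
    Fe (symmDiff X {j}) → (if (i ∈ X ↔ j ∈ X) then
      (σ X = σ (symmDiff X {i, j}) → σ (symmDiff X {i}) = σ (symmDiff X {j})) else
      (σ (symmDiff X {i}) = σ (symmDiff X {j}) → σ X = σ (symmDiff X {i, j})))

lemma card_flip (X : Finset (Fin n)) (i : Fin n) :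
    ((symmDiff X {i}).card : ℤ) = X.card + if i ∈ X then -1 else 1 := by
  split_ifs with h
  · have : symmDiff X {i} = X.erase i := by ext t; by_cases t = i <;> simp_all [Finset.mem_symmDiff]
    rw [this, Finset.card_erase_of_mem h, Nat.cast_sub (Finset.card_pos.2 ⟨i, h⟩)]; simp; ring
  · have : symmDiff X {i} = insert i X := by ext t; by_cases t = i <;> simp_all [Finset.mem_symmDiff]
    rw [this, Finset.card_insert_of_notMem h]; simp

lemma mem_flip (X : Finset (Fin n)) (i t : Fin n) :
    t ∈ symmDiff X {i} ↔ ¬ (t ∈ X ↔ t = i) := by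
  simp [Finset.mem_symmDiff]; tauto

lemma mem_flip2 (X : Finset (Fin n)) (i j t : Fin n) :
    t ∈ symmDiff X {i, j} ↔ ¬ (t ∈ X ↔ (t = i ∨ t = j)) := by
  simp [Finset.mem_symmDiff]; tauto

lemma mem_sd (X Y : Finset (Fin n)) (t : Fin n) :
    t ∈ symmDiff X Y ↔ ¬ (t ∈ X ↔ t ∈ Y) := by
  simp [Finset.mem_symmDiff]; tauto

lemma flip2_eq (X : Finset (Fin n)) (i j : Fin n) (h : i ≠ j) :
    symmDiff X {i, j} = symmDiff (symmDiff X {i}) {j} := by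
  ext t; simp only [mem_flip2, mem_flip]
  by_cases h1 : t = i <;> by_cases h2 : t = j <;> simp_all

lemma eq_flip_of_sd {X Y : Finset (Fin n)} {T : Finset (Fin n)} (h : symmDiff X Y = T) :
    Y = symmDiff X T := by
  rw [← h]; simp

lemma card_flip2 (X : Finset (Fin n)) (i j : Fin n) (h : i ≠ j) :
    ((symmDiff X {i, j}).card : ℤ) =
      X.card + (if i ∈ X then -1 else 1) + if j ∈ X then -1 else 1 := by
  rw [flip2_eq X i j h, card_flip, card_flip]
  have : j ∈ symmDiff X {i} ↔ j ∈ X := by rw [mem_flip]; have := h.symm; tauto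
  simp [this]

variable {Fe : Finset (Fin n) → Prop} {σ : Finset (Fin n) → ℤ}

lemma DD_one {X Y : Finset (Fin n)} (h : (symmDiff X Y).card = 1) :
    DD Fe σ X Y = σ X * σ Y * ((X.card : ℤ) - Y.card) := by
  rw [DD, dif_neg, if_pos h]
  rintro ⟨⟨W, -, h1, h2, h3⟩, -⟩
  have a := h3.card_left h2
  have : symmDiff X W = ∅ := by rw [← Finset.card_eq_zero]; omega
  exact h1 (symmDiff_eq_bot.1 this).symm

lemma DD_self (X : Finset (Fin n)) : DD Fe σ X X = 0 := by
  rw [DD, dif_neg, if_neg]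
  · simp
  · rintro ⟨⟨W, -, h1, h2, h3⟩, -⟩
    have a := h3.card_left h2
    simp at a

lemma DD_flip (X : Finset (Fin n)) (i : Fin n) :
    DD Fe σ X (symmDiff X {i}) = σ X * σ (symmDiff X {i}) * (if i ∈ X then 1 else -1) := by
  rw [DD_one (by simp), card_flip]
  split_ifs <;> ring

lemma DD_zero {X Y : Finset (Fin n)} (h : (symmDiff X Y).card = 2) {t : Fin n}
    (ht : t ∈ symmDiff X Y) (hn : ¬ Fe (symmDiff X {t})) : DD Fe σ X Y = 0 := by
  rw [DD, dif_neg, if_neg]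
  · omega
  · rintro ⟨-, h2⟩
    exact hn (h2 h t ht)

lemma DD_split {X Y : Finset (Fin n)} (h : SplitAt Fe X Y) :
    ∃ W, Fe W ∧ W ≠ X ∧ W ≠ Y ∧ Intv X Y W ∧ DD Fe σ X Y = DD Fe σ X W + DD Fe σ W Y := by
  refine ⟨h.1.choose, h.1.choose_spec.1, h.1.choose_spec.2.1, h.1.choose_spec.2.2.1,
    h.1.choose_spec.2.2.2, ?_⟩
  rw [DD, dif_pos h]

lemma DD_three (H : SDM Fe σ) {X Y : Finset (Fin n)} (hX : Fe X) (hY : Fe Y)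
    (h : 3 ≤ (symmDiff X Y).card) :
    ∃ W, Fe W ∧ W ≠ X ∧ W ≠ Y ∧ Intv X Y W ∧ DD Fe σ X Y = DD Fe σ X W + DD Fe σ W Y := by
  apply DD_split
  refine ⟨?_, fun h => by omega⟩
  obtain ⟨k, hk⟩ : (symmDiff X Y).Nonempty := Finset.card_pos.1 (by omega)
  obtain ⟨j, hj, hW⟩ := H.ex X Y hX hY k hk
  refine ⟨_, hW, ?_, ?_, ?_⟩
  · intro he
    have := congrArg (k ∈ ·) he
    simp [mem_flip2] at this
  · intro he
    have : symmDiff X Y = {k, j} := by rw [← he]; simp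
    have h2 := Finset.card_le_two (a := k) (b := j)
    rw [← this] at h2; omega
  · intro t ht
    rw [mem_sd] at hj hk
    rw [mem_flip2]
    have h1 : t ≠ k := by rintro rfl; tauto
    have h2 : t ≠ j := by rintro rfl; tauto
    tauto


/-- `X` and `Y` agree outside `S`. -/
def FaceS (S X Y : Finset (Fin n)) : Prop := ∀ t, t ∉ S → (t ∈ X ↔ t ∈ Y)
/-- `X` and `Y` disagree on all of `S`. -/
def AntiS (S X Y : Finset (Fin n)) : Prop := ∀ t, t ∈ S → ¬ (t ∈ X ↔ t ∈ Y)
/-- Cocycle property on faces with direction `S`. -/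
def CocS (Fe : Finset (Fin n) → Prop) (σ : Finset (Fin n) → ℤ) (S : Finset (Fin n)) : Prop :=
  ∀ X Y Z, Fe X → Fe Y → Fe Z → FaceS S X Y → FaceS S Y Z →
    DD Fe σ X Y + DD Fe σ Y Z = DD Fe σ X Z

lemma FaceS.symm {S X Y : Finset (Fin n)} (h : FaceS S X Y) : FaceS S Y X :=
  fun t ht => (h t ht).symm
lemma FaceS.trans {S X Y Z : Finset (Fin n)} (h : FaceS S X Y) (h' : FaceS S Y Z) : FaceS S X Z :=
  fun t ht => (h t ht).trans (h' t ht)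
lemma AntiS.symm {S X Y : Finset (Fin n)} (h : AntiS S X Y) : AntiS S Y X :=
  fun t ht h' => h t ht h'.symm

/-- antipodes are unique -/
lemma AntiS.unique {S X Y Z : Finset (Fin n)} (h : AntiS S X Y) (h' : AntiS S X Z)
    (f : FaceS S Y Z) : Y = Z := by
  ext t
  by_cases ht : t ∈ S
  · have := h t ht; have := h' t ht; grind
  · exact f t ht

lemma AntiS.sd {S X Y : Finset (Fin n)} (h : AntiS S X Y) (f : FaceS S X Y) :
    symmDiff X Y = S := by
  ext t
  rw [mem_sd]
  have := h t; have := f t; grind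

variable {S : Finset (Fin n)}

lemma coc_common (IH : ∀ S' : Finset (Fin n), S'.card < S.card → CocS Fe σ S')
    {X Y Z : Finset (Fin n)} (hX : Fe X) (hY : Fe Y) (hZ : Fe Z) (f : FaceS S X Y)
    (f' : FaceS S Y Z) (hc : ∃ t ∈ S, (t ∈ X ↔ t ∈ Y) ∧ (t ∈ Y ↔ t ∈ Z)) :
    DD Fe σ X Y + DD Fe σ Y Z = DD Fe σ X Z := by
  obtain ⟨t, ht, h1, h2⟩ := hc
  refine IH (S.erase t) (Finset.card_erase_lt_of_mem ht) X Y Z hX hY hZ ?_ ?_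
  · intro u hu
    by_cases e : u = t
    · rw [e]; exact h1
    · exact f u (fun h => hu (Finset.mem_erase.2 ⟨e, h⟩))
  · intro u hu
    by_cases e : u = t
    · rw [e]; exact h2
    · exact f' u (fun h => hu (Finset.mem_erase.2 ⟨e, h⟩))

lemma coc_anti (IH : ∀ S' : Finset (Fin n), S'.card < S.card → CocS Fe σ S')
    {X Y : Finset (Fin n)} (hX : Fe X) (hY : Fe Y) (f : FaceS S X Y) (hn : ¬ AntiS S X Y) :
    DD Fe σ X Y + DD Fe σ Y X = 0 := by
  rw [← DD_self (Fe := Fe) (σ := σ) X]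
  unfold AntiS at hn
  push Not at hn
  obtain ⟨t, ht, h⟩ := hn
  exact coc_common IH hX hY hX f f.symm ⟨t, ht, by grind, by grind⟩

/-- find a connecting vertex -/
lemma exists_conn (H : SDM Fe σ) {X Y Z : Finset (Fin n)} (hX : Fe X) (hY : Fe Y)
    (f : FaceS S X Y) (f' : FaceS S Y Z)
    (hc : ∀ t ∈ S, ¬ ((t ∈ X ↔ t ∈ Y) ∧ (t ∈ Y ↔ t ∈ Z)))
    (h1 : ¬ AntiS S X Y) (h2 : ¬ AntiS S Y Z)
    (h4 : ∃ p ∈ S, ∃ q ∈ S, p ≠ q ∧ (p ∈ X ↔ p ∈ Z) ∧ (q ∈ X ↔ q ∈ Z)) :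
    ∃ W, Fe W ∧ FaceS S X W ∧ (∃ t ∈ S, (t ∈ X ↔ t ∈ W) ∧ (t ∈ Y ↔ t ∈ W)) ∧
      (∃ t ∈ S, (t ∈ Y ↔ t ∈ W) ∧ (t ∈ Z ↔ t ∈ W)) ∧
      (∃ t ∈ S, (t ∈ X ↔ t ∈ W) ∧ (t ∈ Z ↔ t ∈ W)) := by
  unfold AntiS at h1 h2
  push Not at h1 h2
  obtain ⟨z, hz, h1⟩ := h1
  obtain ⟨k, hk, h2⟩ := h2
  have hkk : k ∈ symmDiff X Y := by rw [mem_sd]; have := hc k hk; grind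
  obtain ⟨j, hj, hW⟩ := H.ex X Y hX hY k hkk
  rw [mem_sd] at hkk hj
  refine ⟨_, hW, ?_, ⟨z, hz, ?_⟩, ⟨k, hk, ?_⟩, ?_⟩
  · intro t ht
    have h := f t ht
    have h1 : t ≠ k := by rintro rfl; grind
    have h2 : t ≠ j := by rintro rfl; grind
    rw [mem_flip2]; grind
  · have e1 : z ≠ k := by rintro rfl; grind
    have e2 : z ≠ j := by rintro rfl; grind
    rw [mem_flip2]; grind
  · rw [mem_flip2]; have := hc k hk; grind
  · obtain ⟨p, hp, q, hq, hpq, hpp, hqq⟩ := h4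
    have key : ∀ r ∈ S, r ≠ j → (r ∈ X ↔ r ∈ Z) → ∃ t ∈ S, (t ∈ X ↔ t ∈ symmDiff X {k, j}) ∧
        (t ∈ Z ↔ t ∈ symmDiff X {k, j}) := by
      intro r hr hrj hrr
      have e1 : r ≠ k := by rintro rfl; have := hc r hr; grind
      refine ⟨r, hr, ?_⟩
      rw [mem_flip2]; grind
    by_cases e : p = j
    · exact key q hq (fun h => hpq (e.trans h.symm)) hqq
    · exact key p hp e hpp

/-- nonantipodal triples -/
lemma coc_triple (H : SDM Fe σ) (IH : ∀ S' : Finset (Fin n), S'.card < S.card → CocS Fe σ S')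
    {X Y Z : Finset (Fin n)} (hX : Fe X) (hY : Fe Y) (hZ : Fe Z) (f : FaceS S X Y)
    (f' : FaceS S Y Z) (h1 : ¬ AntiS S X Y) (h2 : ¬ AntiS S Y Z) (h3 : ¬ AntiS S X Z) :
    DD Fe σ X Y + DD Fe σ Y Z = DD Fe σ X Z := by
  by_cases hc : ∃ t ∈ S, (t ∈ X ↔ t ∈ Y) ∧ (t ∈ Y ↔ t ∈ Z)
  · exact coc_common IH hX hY hZ f f' hc
  have hc0 : ∀ t ∈ S, ¬ ((t ∈ X ↔ t ∈ Y) ∧ (t ∈ Y ↔ t ∈ Z)) := fun t ht h => hc ⟨t, ht, h⟩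
  have main : (∃ W, Fe W ∧ FaceS S X W ∧ (∃ t ∈ S, (t ∈ X ↔ t ∈ W) ∧ (t ∈ Y ↔ t ∈ W)) ∧
      (∃ t ∈ S, (t ∈ Y ↔ t ∈ W) ∧ (t ∈ Z ↔ t ∈ W)) ∧
      (∃ t ∈ S, (t ∈ X ↔ t ∈ W) ∧ (t ∈ Z ↔ t ∈ W))) →
      DD Fe σ X Y + DD Fe σ Y Z = DD Fe σ X Z := by
    rintro ⟨W, hW, g, ⟨a, ha, ha1, ha2⟩, ⟨b, hb, hb1, hb2⟩, ⟨c, hc, hc1, hc2⟩⟩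
    have e1 := coc_common IH hX hW hY g (g.symm.trans f) ⟨a, ha, ha1, ha2.symm⟩
    have e2 := coc_common IH hY hW hZ (f.symm.trans g) (g.symm.trans (f.trans f'))
      ⟨b, hb, hb1, hb2.symm⟩
    have e3 := coc_common IH hX hW hZ g (g.symm.trans (f.trans f')) ⟨c, hc, hc1, hc2.symm⟩
    have e4 := coc_anti IH hW hY (g.symm.trans f) (fun h => h a ha ha2.symm)
    linarith
  by_cases c1 : ∃ p ∈ S, ∃ q ∈ S, p ≠ q ∧ (p ∈ X ↔ p ∈ Z) ∧ (q ∈ X ↔ q ∈ Z)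
  · exact main (exists_conn H hX hY f f' hc0 h1 h2 c1)
  by_cases c2 : ∃ p ∈ S, ∃ q ∈ S, p ≠ q ∧ (p ∈ Y ↔ p ∈ Z) ∧ (q ∈ Y ↔ q ∈ Z)
  · obtain ⟨W, hW, g, a, b, c⟩ := exists_conn (X := Y) (Y := X) (Z := Z) H hY hX f.symm
      (f.trans f') (fun t ht => by have := hc0 t ht; grind) (fun h => h1 h.symm) h3 c2
    refine main ⟨W, hW, f.trans g, ?_, c, b⟩
    obtain ⟨t, ht, h, h'⟩ := a
    exact ⟨t, ht, h', h⟩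
  by_cases c3 : ∃ p ∈ S, ∃ q ∈ S, p ≠ q ∧ (p ∈ X ↔ p ∈ Y) ∧ (q ∈ X ↔ q ∈ Y)
  · obtain ⟨W, hW, g, a, b, c⟩ := exists_conn (X := X) (Y := Z) (Z := Y) H hX hZ (f.trans f')
      f'.symm (fun t ht => by have := hc0 t ht; grind) h3 (fun h => h2 h.symm) c3
    refine main ⟨W, hW, g, c, ?_, a⟩
    obtain ⟨t, ht, h, h'⟩ := b
    exact ⟨t, ht, h', h⟩
  unfold AntiS at h1 h2 h3
  push Not at h1 h2 h3
  obtain ⟨z, hz, h1⟩ := h1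
  obtain ⟨x, hx, h2⟩ := h2
  obtain ⟨y, hy, h3⟩ := h3
  have ux : ∀ t ∈ S, (t ∈ Y ↔ t ∈ Z) → t = x := fun t ht h => by
    by_contra e; exact c2 ⟨t, ht, x, hx, e, h, by grind⟩
  have uy : ∀ t ∈ S, (t ∈ X ↔ t ∈ Z) → t = y := fun t ht h => by
    by_contra e; exact c1 ⟨t, ht, y, hy, e, h, by grind⟩
  have uz : ∀ t ∈ S, (t ∈ X ↔ t ∈ Y) → t = z := fun t ht h => by
    by_contra e; exact c3 ⟨t, ht, z, hz, e, h, by grind⟩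
  have hcx := hc0 x hx
  have hcy := hc0 y hy
  have hcz := hc0 z hz
  have nxy : x ≠ y := by rintro rfl; grind
  have nxz : x ≠ z := by rintro rfl; grind
  have nyz : y ≠ z := by rintro rfl; grind
  have sXY : symmDiff X Y = {x, y} := by
    ext t; rw [mem_sd]; simp only [Finset.mem_insert, Finset.mem_singleton]
    by_cases ht : t ∈ S
    · have a1 := ux t ht; have a2 := uy t ht; have a3 := uz t ht
      constructor
      · grind
      · rintro (rfl | rfl) <;> grind
    · have := f t ht
      have : t ≠ x := by rintro rfl; exact ht hx
      have : t ≠ y := by rintro rfl; exact ht hy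
      grind
  have sYZ : symmDiff Y Z = {y, z} := by
    ext t; rw [mem_sd]; simp only [Finset.mem_insert, Finset.mem_singleton]
    by_cases ht : t ∈ S
    · have a1 := ux t ht; have a2 := uy t ht; have a3 := uz t ht
      constructor
      · grind
      · rintro (rfl | rfl) <;> grind
    · have := f' t ht
      have : t ≠ z := by rintro rfl; exact ht hz
      have : t ≠ y := by rintro rfl; exact ht hy
      grind
  have sXZ : symmDiff X Z = {x, z} := by
    ext t; rw [mem_sd]; simp only [Finset.mem_insert, Finset.mem_singleton]
    by_cases ht : t ∈ S
    · have a1 := ux t ht; have a2 := uy t ht; have a3 := uz t ht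
      constructor
      · grind
      · rintro (rfl | rfl) <;> grind
    · have := (f.trans f') t ht
      have : t ≠ z := by rintro rfl; exact ht hz
      have : t ≠ x := by rintro rfl; exact ht hx
      grind
  by_cases hM : Fe (symmDiff X {x})
  · refine main ⟨_, hM, ?_, ⟨z, hz, ?_⟩, ⟨x, hx, ?_⟩, ⟨y, hy, ?_⟩⟩
    · intro t ht
      have : t ≠ x := by rintro rfl; exact ht hx
      rw [mem_flip]; grind
    · have := nxz.symm
      rw [mem_flip]; grind
    · rw [mem_flip]; grind
    · have := nxy.symm
      rw [mem_flip]; grind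
  · have eM : symmDiff X {x} = symmDiff Y {y} := by
      rw [eq_flip_of_sd sXY, flip2_eq _ _ _ nxy]; simp
    rw [DD_zero (t := x) (by rw [sXY, Finset.card_pair nxy]) (by rw [sXY]; simp) hM,
      DD_zero (t := y) (by rw [sYZ, Finset.card_pair nyz]) (by rw [sYZ]; simp) (eM ▸ hM),
      DD_zero (t := x) (by rw [sXZ, Finset.card_pair nxz]) (by rw [sXZ]; simp) hM]
    rfl


lemma DD_triangle (H : SDM Fe σ) {X : Finset (Fin n)} {i j : Fin n} (hij : i ≠ j) (hX : Fe X)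
    (hZ : Fe (symmDiff X {i, j})) (hY : Fe (symmDiff X {i})) (hn : ¬ Fe (symmDiff X {j})) :
    DD Fe σ X (symmDiff X {i}) + DD Fe σ (symmDiff X {i}) (symmDiff X {i, j}) = 0 := by
  have hl := H.long X i j hij hX hZ (fun h => hn h.2)
  rw [flip2_eq X i j hij] at hl ⊢
  rw [DD_flip, DD_flip, hl]
  have hm : j ∈ symmDiff X {i} ↔ j ∈ X := by rw [mem_flip]; grind
  simp only [hm]
  by_cases h1 : i ∈ X <;> by_cases h2 : j ∈ X <;> simp [h1, h2] <;> ring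

lemma DD_square (H : SDM Fe σ) {X : Finset (Fin n)} {i j : Fin n} (hij : i ≠ j) (hX : Fe X)
    (hZ : Fe (symmDiff X {i, j})) (hi : Fe (symmDiff X {i})) (hj : Fe (symmDiff X {j})) :
    DD Fe σ X (symmDiff X {i}) + DD Fe σ (symmDiff X {i}) (symmDiff X {i, j}) =
    DD Fe σ X (symmDiff X {j}) + DD Fe σ (symmDiff X {j}) (symmDiff X {i, j}) := by
  have hs := H.sq X i j hij hX hZ hi hj
  have p1 := H.pm _ hX
  have p2 := H.pm _ hZ
  have p3 := H.pm _ hi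
  have p4 := H.pm _ hj
  have e1 : DD Fe σ (symmDiff X {i}) (symmDiff X {i, j}) =
    σ (symmDiff X {i}) * σ (symmDiff X {i, j}) * (if j ∈ X then 1 else -1) := by
    have hm : j ∈ symmDiff X {i} ↔ j ∈ X := by rw [mem_flip]; grind
    rw [flip2_eq X i j hij, DD_flip]; simp only [hm]
  have e2 : DD Fe σ (symmDiff X {j}) (symmDiff X {i, j}) =
    σ (symmDiff X {j}) * σ (symmDiff X {i, j}) * (if i ∈ X then 1 else -1) := by
    have hm : i ∈ symmDiff X {j} ↔ i ∈ X := by rw [mem_flip]; grind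
    rw [Finset.pair_comm, flip2_eq X j i hij.symm, DD_flip]; simp only [hm]
  rw [e1, e2, DD_flip, DD_flip]
  by_cases h1 : i ∈ X <;> by_cases h2 : j ∈ X <;> simp [h1, h2] at hs ⊢ <;>
  rcases p1 with p1 | p1 <;> rcases p2 with p2 | p2 <;> rcases p3 with p3 | p3 <;>
  rcases p4 with p4 | p4 <;> simp [p1, p2, p3, p4] at hs ⊢

/-- rectangle: `Y, X = Y+t, V = Y+{p,q}, Z = V + t` -/
lemma DD_rect (H : SDM Fe σ) {Y : Finset (Fin n)} {t p q : Fin n} (hpq : p ≠ q) (htp : t ≠ p)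
    (htq : t ≠ q) (hY : Fe Y) (hX : Fe (symmDiff Y {t})) (hV : Fe (symmDiff Y {p, q}))
    (hZ : Fe (symmDiff (symmDiff Y {t}) {p, q})) (h1 : ¬ Fe (symmDiff Y {p}))
    (h2 : ¬ Fe (symmDiff (symmDiff Y {t}) {p})) :
    DD Fe σ Y (symmDiff Y {t}) =
      DD Fe σ (symmDiff Y {p, q}) (symmDiff (symmDiff Y {t}) {p, q}) := by
  have l1 := H.long Y p q hpq hY hV (fun h => h1 h.1)
  have l2 := H.long _ p q hpq hX hZ (fun h => h2 h.1)
  have hp : p ∈ symmDiff Y {t} ↔ p ∈ Y := by rw [mem_flip]; grind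
  have hq : q ∈ symmDiff Y {t} ↔ q ∈ Y := by rw [mem_flip]; grind
  have ht : t ∈ symmDiff Y {p, q} ↔ t ∈ Y := by rw [mem_flip2]; grind
  have e : symmDiff (symmDiff Y {t}) {p, q} = symmDiff (symmDiff Y {p, q}) {t} := by
    rw [symmDiff_right_comm]
  simp only [hp, hq] at l2
  rw [e] at l2 ⊢
  rw [DD_flip, DD_flip, l1, l2]
  simp only [ht]
  split_ifs <;> ring

lemma coc_ind0 (H : SDM Fe σ) (IH : ∀ S' : Finset (Fin n), S'.card < S.card → CocS Fe σ S')
    {X Y Z V : Finset (Fin n)} (hX : Fe X) (hY : Fe Y) (hZ : Fe Z) (hV : Fe V)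
    (a : AntiS S Y Z) (fZ : FaceS S Y Z) (fX : FaceS S Y X) (fV : FaceS S Y V)
    (nX : X ≠ Y) (nX' : X ≠ Z) (nV : V ≠ Y) (nV' : V ≠ Z) (na : ¬ AntiS S X V) :
    DD Fe σ Y X + DD Fe σ X Z = DD Fe σ Y V + DD Fe σ V Z := by
  have e1 := coc_triple H IH hY hX hV fX (fX.symm.trans fV)
    (fun h => nX' (h.unique a (fX.symm.trans fZ))) na (fun h => nV' (h.unique a (fV.symm.trans fZ)))
  have e2 := coc_triple H IH hX hV hZ (fX.symm.trans fV) (fV.symm.trans fZ)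
    na (fun h => nV (h.symm.unique a.symm fV.symm))
    (fun h => nX (h.symm.unique a.symm fX.symm))
  linarith

lemma card_le_two_of_four (H : SDM Fe σ) {X Y Z V : Finset (Fin n)} (hX : Fe X) (hY : Fe Y)
    (a : AntiS S Y Z) (a' : AntiS S X V) (fZ : FaceS S Y Z) (fX : FaceS S Y X) (fV : FaceS S Y V)
    (nX : X ≠ Y) (nX' : X ≠ Z) (nV : V ≠ Y) (nV' : V ≠ Z)
    (hU : ∀ U, Fe U → FaceS S Y U → U = X ∨ U = Y ∨ U = Z ∨ U = V) :
    (symmDiff Y X).card ≤ 2 := by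
  by_contra hcon
  obtain ⟨W, hW, n1, n2, hI, -⟩ := DD_three H hY hX (by omega)
  have fW : FaceS S Y W := fun t ht => (hI t (fX t ht)).symm
  rcases hU W hW fW with rfl | rfl | rfl | rfl
  · exact n2 rfl
  · exact n1 rfl
  · apply nX'
    ext t
    by_cases ht : t ∈ S
    · have := a t ht; have := hI t; grind
    · have := fX t ht; have := fW t ht; grind
  · apply nV
    ext t
    by_cases ht : t ∈ S
    · have := a' t ht; have := hI t; grind
    · have := fW t ht; grind

lemma coc_ind (H : SDM Fe σ) (IH : ∀ S' : Finset (Fin n), S'.card < S.card → CocS Fe σ S')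
    {X Y Z V : Finset (Fin n)} (hX : Fe X) (hY : Fe Y) (hZ : Fe Z) (hV : Fe V)
    (a : AntiS S Y Z) (fZ : FaceS S Y Z) (fX : FaceS S Y X) (fV : FaceS S Y V)
    (nX : X ≠ Y) (nX' : X ≠ Z) (nV : V ≠ Y) (nV' : V ≠ Z) :
    DD Fe σ Y X + DD Fe σ X Z = DD Fe σ Y V + DD Fe σ V Z := by
  by_cases a' : AntiS S X V
  swap
  · exact coc_ind0 H IH hX hY hZ hV a fZ fX fV nX nX' nV nV' a'
  by_cases hU : ∀ U, Fe U → FaceS S Y U → U = X ∨ U = Y ∨ U = Z ∨ U = V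
  swap
  · push Not at hU
    obtain ⟨U, hU, fU, u1, u2, u3, u4⟩ := hU
    rw [coc_ind0 H IH hX hY hZ hU a fZ fX fU nX nX' u2 u3
      (fun h => u4 (h.unique a' (fU.symm.trans fV))),
      coc_ind0 H IH hU hY hZ hV a fZ fU fV u2 u3 nV nV'
      (fun h => u1 (h.symm.unique a'.symm (fU.symm.trans fX)))]
  have cX := card_le_two_of_four H hX hY a a' fZ fX fV nX nX' nV nV' hU
  have cV := card_le_two_of_four H hV hY a a'.symm fZ fV fX nV nV' nX nX'
    (fun U h1 h2 => by have := hU U h1 h2; tauto)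
  set T := symmDiff Y X with hT
  set R := symmDiff Y V with hR
  have eX : X = symmDiff Y T := by simp [hT]
  have eV : V = symmDiff Y R := by simp [hR]
  have dTR : ∀ t, t ∈ T → t ∉ R := by
    intro t ht hr
    rw [hT, mem_sd] at ht
    rw [hR, mem_sd] at hr
    by_cases hs : t ∈ S
    · have := a' t hs; tauto
    · exact ht (fX t hs)
  have eZ : Z = symmDiff (symmDiff Y T) R := by
    ext t
    have h1 : t ∈ T ↔ ¬ (t ∈ Y ↔ t ∈ X) := mem_sd _ _ _
    have h2 : t ∈ R ↔ ¬ (t ∈ Y ↔ t ∈ V) := mem_sd _ _ _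
    rw [mem_sd, mem_sd]
    by_cases hs : t ∈ S
    · have := a t hs; have := a' t hs; grind
    · have := fX t hs; have := fV t hs; have := fZ t hs; grind
  have eZ' : Z = symmDiff (symmDiff Y R) T := by
    rw [eZ, symmDiff_right_comm]
  have pT : 0 < T.card := Finset.card_pos.2 (by
    rw [Finset.nonempty_iff_ne_empty]; intro h; exact nX (symmDiff_eq_bot.1 (hT.symm.trans h)).symm)
  have pR : 0 < R.card := Finset.card_pos.2 (by
    rw [Finset.nonempty_iff_ne_empty]; intro h; exact nV (symmDiff_eq_bot.1 (hR.symm.trans h)).symm)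
  clear_value T R
  -- no feasible points besides the four
  have noF : ∀ K : Finset (Fin n), K ⊆ T ∪ R → K ≠ ∅ → K ≠ T → K ≠ R → K ≠ T ∪ R →
      ¬ Fe (symmDiff Y K) := by
    intro K hK k1 k2 k3 k4 hF
    have fK : FaceS S Y (symmDiff Y K) := by
      intro t ht
      rw [mem_sd]
      have : t ∉ K := by
        intro h
        have h5 := hK h
        have := fX t ht
        have := fV t ht
        rw [Finset.mem_union, hT, hR, mem_sd, mem_sd] at h5
        tauto
      tauto
    rcases hU _ hF fK with h | h | h | h
    · exact k2 (symmDiff_right_injective Y (h.trans eX))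
    · simp at h; exact k1 h
    · apply k4
      rw [eZ, symmDiff_assoc] at h
      rw [symmDiff_right_injective Y h]
      ext t; rw [mem_sd, Finset.mem_union]; have := dTR t; tauto
    · exact k3 (symmDiff_right_injective Y (h.trans eV))
  have t12 : T.card = 1 ∨ T.card = 2 := by omega
  have r12 : R.card = 1 ∨ R.card = 2 := by omega
  rcases t12 with t1 | t2 <;> rcases r12 with r1 | r2
  · obtain ⟨i, rfl⟩ := Finset.card_eq_one.1 t1
    obtain ⟨j, rfl⟩ := Finset.card_eq_one.1 r1
    have hij : i ≠ j := by
      intro h; exact dTR i (by simp) (by simp [h])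
    rw [← flip2_eq Y i j hij] at eZ
    subst eX eV eZ
    exact DD_square H hij hY hZ hX hV
  · obtain ⟨t, rfl⟩ := Finset.card_eq_one.1 t1
    obtain ⟨p, q, hpq, rfl⟩ := Finset.card_eq_two.1 r2
    have htp : t ≠ p := by intro h; exact dTR t (by simp) (by simp [h])
    have htq : t ≠ q := by intro h; exact dTR t (by simp) (by simp [h])
    have z1 : ¬ Fe (symmDiff Y {p}) := noF _ (by intro u; simp; grind) (by simp)
      (by simpa using htp.symm) (by intro h; have := congrArg Finset.card h; simp [hpq] at this)
      (by intro h; have : t ∈ ({p} : Finset (Fin n)) := by rw [h]; simp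
          simp [htp] at this)
    have z2 : ¬ Fe (symmDiff (symmDiff Y {t}) {p}) := by
      rw [← flip2_eq _ _ _ htp]
      refine noF _ (by intro u; simp; grind) (by simp) ?_ ?_ ?_
      · intro h; have := congrArg Finset.card h; simp [htp] at this
      · intro h; have : t ∈ ({p, q} : Finset (Fin n)) := by rw [← h]; simp
        simp [htp, htq] at this
      · intro h; have : q ∈ ({t, p} : Finset (Fin n)) := by rw [h]; simp
        simp [htq.symm, hpq.symm] at this
    subst eX eV eZ
    rw [DD_zero (X := symmDiff Y {t}) (Y := symmDiff (symmDiff Y {t}) {p, q}) (t := p) (by simp [hpq]) (by simp) z2,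
      DD_zero (X := Y) (Y := symmDiff Y {p, q}) (t := p) (by simp [hpq]) (by simp) z1,
      DD_rect H hpq htp htq hY hX hV hZ z1 z2]
    ring
  · obtain ⟨t, rfl⟩ := Finset.card_eq_one.1 r1
    obtain ⟨p, q, hpq, rfl⟩ := Finset.card_eq_two.1 t2
    have htp : t ≠ p := by intro h; exact dTR p (by simp) (by simp [h])
    have htq : t ≠ q := by intro h; exact dTR q (by simp) (by simp [h])
    have z1 : ¬ Fe (symmDiff Y {p}) := noF _ (by intro u; simp; grind) (by simp)
      (by intro h; have := congrArg Finset.card h; simp [hpq] at this) (by simpa using htp.symm)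
      (by intro h; have : t ∈ ({p} : Finset (Fin n)) := by rw [h]; simp
          simp [htp] at this)
    have z2 : ¬ Fe (symmDiff (symmDiff Y {t}) {p}) := by
      rw [← flip2_eq _ _ _ htp]
      refine noF _ (by intro u; simp; grind) (by simp) ?_ ?_ ?_
      · intro h; have : t ∈ ({p, q} : Finset (Fin n)) := by rw [← h]; simp
        simp [htp, htq] at this
      · intro h; have := congrArg Finset.card h; simp [htp] at this
      · intro h; have : q ∈ ({t, p} : Finset (Fin n)) := by rw [h]; simp
        simp [htq.symm, hpq.symm] at this
    clear eZ
    subst eX eV eZ'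
    rw [DD_zero (X := symmDiff Y {t}) (Y := symmDiff (symmDiff Y {t}) {p, q}) (t := p) (by simp [hpq]) (by simp) z2,
      DD_zero (X := Y) (Y := symmDiff Y {p, q}) (t := p) (by simp [hpq]) (by simp) z1,
      DD_rect H hpq htp htq hY hV hX hZ z1 z2]
    ring
  · obtain ⟨i, j, hij, rfl⟩ := Finset.card_eq_two.1 t2
    obtain ⟨p, q, hpq, rfl⟩ := Finset.card_eq_two.1 r2
    have d1 := dTR i (by simp)
    have d2 := dTR j (by simp)
    simp only [Finset.mem_insert, Finset.mem_singleton, not_or] at d1 d2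
    have noF' : ∀ K : Finset (Fin n), K ⊆ {i, j} ∪ {p, q} → K.card = 1 ∨ K.card = 3 →
        ¬ Fe (symmDiff Y K) := by
      intro K hK hc
      refine noF K hK ?_ ?_ ?_ ?_
      · rintro rfl; simp at hc
      · rintro rfl; omega
      · rintro rfl; omega
      · rintro rfl
        rw [Finset.card_union_of_disjoint (by
          rw [Finset.disjoint_left]; exact dTR)] at hc
        omega
    have z1 : ¬ Fe (symmDiff Y {i}) := noF' _ (by simp) (by simp)
    have z2 : ¬ Fe (symmDiff Y {p}) := noF' _ (by simp) (by simp)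
    have z3 : ¬ Fe (symmDiff (symmDiff Y {i, j}) {p}) := by
      have : symmDiff (symmDiff Y {i, j}) {p} = symmDiff Y {i, j, p} := by
        ext t; simp only [mem_sd, Finset.mem_insert, Finset.mem_singleton]; grind
      rw [this]
      refine noF' _ (by intro u; simp; grind) (Or.inr ?_)
      rw [Finset.card_eq_three]; exact ⟨i, j, p, hij, d1.1, d2.1, rfl⟩
    have z4 : ¬ Fe (symmDiff (symmDiff Y {p, q}) {i}) := by
      have : symmDiff (symmDiff Y {p, q}) {i} = symmDiff Y {p, q, i} := by
        ext t; simp only [mem_sd, Finset.mem_insert, Finset.mem_singleton]; grind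
      rw [this]
      refine noF' _ (by intro u; simp; grind) (Or.inr ?_)
      rw [Finset.card_eq_three]; exact ⟨p, q, i, hpq, Ne.symm d1.1, Ne.symm d1.2, rfl⟩
    rw [DD_zero (X := Y) (Y := X) (t := i) (by simp [eX, hij]) (by simp [eX]) z1,
      DD_zero (X := Y) (Y := V) (t := p) (by simp [eV, hpq]) (by simp [eV]) z2,
      DD_zero (X := X) (Y := Z) (t := p) (by simp [eX, eZ, hpq]) (by simp [eX, eZ]) (eX ▸ z3),
      DD_zero (X := V) (Y := Z) (t := i) (by simp [eV, eZ', hij]) (by simp [eV, eZ']) (eV ▸ z4)]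

lemma coc_K (H : SDM Fe σ) (IH : ∀ S' : Finset (Fin n), S'.card < S.card → CocS Fe σ S')
    {X Y Z : Finset (Fin n)} (hX : Fe X) (hY : Fe Y) (hZ : Fe Z)
    (a : AntiS S X Z) (fZ : FaceS S X Z) (fY : FaceS S X Y) (nX : Y ≠ X) (nZ : Y ≠ Z) :
    DD Fe σ X Z = DD Fe σ X Y + DD Fe σ Y Z := by
  have hI : Intv X Z Y := by
    intro t ht
    by_cases hs : t ∈ S
    · exact absurd ht (a t hs)
    · exact (fY t hs).symm
  have key : SplitAt Fe X Z → DD Fe σ X Z = DD Fe σ X Y + DD Fe σ Y Z := by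
    intro h
    obtain ⟨W, hW, n1, n2, hI', e⟩ := DD_split (σ := σ) h
    rw [e]
    refine coc_ind H IH hW hX hZ hY a fZ ?_ fY n1 n2 nX nZ
    exact fun t ht => (hI' t (fZ t ht)).symm
  by_cases h2 : (symmDiff X Z).card = 2
  swap
  · exact key ⟨⟨Y, hY, nX, nZ, hI⟩, fun h => absurd h h2⟩
  by_cases hm : ∀ t ∈ symmDiff X Z, Fe (symmDiff X {t})
  · exact key ⟨⟨Y, hY, nX, nZ, hI⟩, fun _ => hm⟩
  push Not at hm
  obtain ⟨j, hj, hn⟩ := hm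
  rw [DD_zero h2 hj hn]
  have c1 := hI.card_left nZ
  have c0 : 0 < (symmDiff X Y).card := Finset.card_pos.2 (by
    rw [Finset.nonempty_iff_ne_empty]; intro h; exact nX (symmDiff_eq_bot.1 h).symm)
  obtain ⟨i, hi⟩ := Finset.card_eq_one.1 (show (symmDiff X Y).card = 1 by omega)
  have eY := eq_flip_of_sd hi
  have hij : i ≠ j := by rintro rfl; exact hn (eY ▸ hY)
  have hiZ : i ∈ symmDiff X Z := by
    have h5 : i ∈ symmDiff X Y := by rw [hi]; simp
    rw [mem_sd] at h5 ⊢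
    have := hI i; tauto
  have eZ : symmDiff X Z = {i, j} := by
    symm
    apply Finset.eq_of_subset_of_card_le
    · intro t; simp only [Finset.mem_insert, Finset.mem_singleton]
      rintro (rfl | rfl) <;> assumption
    · rw [h2, Finset.card_pair hij]
  have eZ := eq_flip_of_sd eZ
  subst eY eZ
  exact (DD_triangle H hij hX hZ hY hn).symm

lemma coc_A (H : SDM Fe σ) (IH : ∀ S' : Finset (Fin n), S'.card < S.card → CocS Fe σ S')
    {X Z : Finset (Fin n)} (hX : Fe X) (hZ : Fe Z)
    (a : AntiS S X Z) (fZ : FaceS S X Z) : DD Fe σ X Z + DD Fe σ Z X = 0 := by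
  by_cases hS : S.card = 0
  · have : X = Z := by
      ext t; exact fZ t (by rw [Finset.card_eq_zero.1 hS]; simp)
    subst this; simp [DD_self]
  by_cases hY : ∃ Y, Fe Y ∧ FaceS S X Y ∧ Y ≠ X ∧ Y ≠ Z
  · obtain ⟨Y, hY, fY, n1, n2⟩ := hY
    rw [coc_K H IH hX hY hZ a fZ fY n1 n2,
      coc_K H IH hZ hY hX a.symm fZ.symm (fZ.symm.trans fY) n2 n1]
    have e1 := coc_anti IH hX hY fY (fun h => n2 (h.unique a (fY.symm.trans fZ)))
    have e2 := coc_anti IH hY hZ (fY.symm.trans fZ) (fun h => n1 (h.symm.unique a.symm fY.symm))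
    linarith
  push Not at hY
  have hsd := a.sd fZ
  have hsd' := a.symm.sd fZ.symm
  have no : ∀ t ∈ S, S.card = 2 → ¬ Fe (symmDiff X {t}) ∧ ¬ Fe (symmDiff Z {t}) := by
    intro t ht hc
    have nt : ({t} : Finset (Fin n)) ≠ S := by
      intro h; rw [← h] at hc; simp at hc
    have fl : ∀ A, FaceS S A (symmDiff A {t}) := by
      intro A u hu
      rw [mem_flip]
      have : u ≠ t := by rintro rfl; exact hu ht
      tauto
    constructor
    · intro h
      have := hY _ h (fl X) (by simp)
      apply nt; rw [← hsd, ← this]; simp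
    · intro h
      by_cases h5 : symmDiff Z {t} = X
      · apply nt; rw [← hsd', ← h5]; simp
      · have := hY _ h (fZ.trans (fl Z)) h5
        simp at this
  have c3 : S.card < 3 := by
    by_contra hc
    obtain ⟨W, hW, n1, n2, hI, -⟩ := DD_three H hX hZ (by rw [hsd]; omega)
    exact n2 (hY W hW (fun t ht => (hI t (fZ t ht)).symm) n1)
  have : S.card = 1 ∨ S.card = 2 := by omega
  rcases this with h1 | h2
  · rw [DD_one (by rw [hsd, h1]), DD_one (by rw [hsd', h1])]; ring
  · obtain ⟨t, ht⟩ := Finset.card_pos.1 (show 0 < S.card by omega)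
    rw [DD_zero (by rw [hsd, h2]) (by rw [hsd]; exact ht) (no t ht h2).1,
      DD_zero (by rw [hsd', h2]) (by rw [hsd']; exact ht) (no t ht h2).2]; rfl

theorem coc_all (H : SDM Fe σ) (S : Finset (Fin n)) : CocS Fe σ S := by
  induction hd : S.card using Nat.strong_induction_on generalizing S with
  | _ d ih =>
  subst hd
  have IH : ∀ S' : Finset (Fin n), S'.card < S.card → CocS Fe σ S' :=
    fun S' h => ih _ h S' rfl
  intro X Y Z hX hY hZ f f'
  by_cases hXY : X = Y
  · subst hXY; simp [DD_self]
  by_cases hYZ : Y = Z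
  · subst hYZ; simp [DD_self]
  by_cases aXZ : AntiS S X Z
  · exact (coc_K H IH hX hY hZ aXZ (f.trans f') f (Ne.symm hXY) hYZ).symm
  by_cases hXZ : X = Z
  · subst hXZ
    rw [DD_self]
    by_cases h : AntiS S X Y
    · exact coc_A H IH hX hY h f
    · exact coc_anti IH hX hY f h
  by_cases aXY : AntiS S X Y
  · have e1 := coc_K H IH hX hZ hY aXY f (f.trans f') (Ne.symm hXZ) (Ne.symm hYZ)
    have e2 := coc_anti IH hY hZ f' (fun h => hXZ (aXY.symm.unique h (f.trans f')))
    linarith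
  by_cases aYZ : AntiS S Y Z
  · have e1 := coc_K H IH hY hX hZ aYZ f' f.symm hXY hXZ
    have e2 := coc_anti IH hX hY f (fun h => aXY h)
    linarith
  exact coc_triple H IH hX hY hZ f f' aXY aYZ aXZ

theorem coc (H : SDM Fe σ) {X Y Z : Finset (Fin n)} (hX : Fe X) (hY : Fe Y) (hZ : Fe Z) :
    DD Fe σ X Y + DD Fe σ Y Z = DD Fe σ X Z :=
  coc_all H Finset.univ X Y Z hX hY hZ (fun t ht => by simp at ht) (fun t ht => by simp at ht)

/-- Bases of maximal size have equal potential. -/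
theorem DD_max (H : SDM Fe σ) {X Y : Finset (Fin n)} (hX : Fe X) (hY : Fe Y)
    (mX : ∀ W, Fe W → W.card ≤ X.card) (mY : ∀ W, Fe W → W.card ≤ Y.card) :
    DD Fe σ X Y = 0 := by
  induction hd : (symmDiff X Y).card using Nat.strong_induction_on generalizing X with
  | _ d ih =>
  subst hd
  by_cases hXY : X = Y
  · subst hXY; exact DD_self X
  have hc : X.card = Y.card := le_antisymm (mY X hX) (mX Y hY)
  have : ¬ Y ⊆ X := fun h => hXY (Finset.eq_of_subset_of_card_le h hc.le).symm
  obtain ⟨k, hkY, hkX⟩ := Finset.not_subset.1 this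
  have hk : k ∈ symmDiff X Y := by rw [mem_sd]; tauto
  obtain ⟨j, hj, hW⟩ := H.ex X Y hX hY k hk
  have nk : ¬ Fe (symmDiff X {k}) := by
    intro h
    have h1 := mX _ h
    have h2 := card_flip X k
    simp [hkX] at h2
    omega
  have hkj : k ≠ j := by
    rintro rfl; apply nk; simpa using hW
  have h2 := card_flip2 X k j hkj
  have hjX : j ∈ X := by
    by_contra h
    simp [hkX, h] at h2
    have := mX _ hW
    omega
  have hI : Intv X Y (symmDiff X {k, j}) := by
    intro t ht
    rw [mem_sd] at hk hj
    rw [mem_flip2]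
    have h1 : t ≠ k := by rintro rfl; tauto
    have h2 : t ≠ j := by rintro rfl; tauto
    tauto
  have hcW : (symmDiff X {k, j}).card = X.card := by
    simp [hkX, hjX] at h2; omega
  have nW : symmDiff X {k, j} ≠ X := by
    intro he
    have := congrArg (k ∈ ·) he
    simp [mem_flip2] at this
  have e := ih _ (hI.card_right nW) hW (by rw [hcW]; exact mX) rfl
  rw [← coc H hX hW hY, e, DD_zero (t := k) (by simp [hkj]) (by simp) nk]
  rfl

end Comb

section Trans
variable {n : ℕ}

/-- The Lagrangian set with starred positions `P`. -/
noncomputable def lag (P : Finset (Fin n)) : Finset (JJ n) :=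
  Finset.univ.filter (fun x => (x.2 = true ↔ x.1 ∈ P))

/-- The starred positions of `A`. -/
noncomputable def posF (A : Finset (JJ n)) : Finset (Fin n) :=
  Finset.univ.filter (fun t => (t, true) ∈ A)

lemma mem_lag (P : Finset (Fin n)) (x : JJ n) : x ∈ lag P ↔ (x.2 = true ↔ x.1 ∈ P) := by
  simp [lag]

lemma card_lag_filter (P : Finset (Fin n)) (q : Fin n → Prop) [DecidablePred q]
    [DecidablePred (fun x : JJ n => q x.1)] :
    ((lag P).filter (fun x => q x.1)).card = (Finset.univ.filter q).card := by
  symm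
  apply Finset.card_bij (fun t _ => ((t, decide (t ∈ P)) : JJ n))
  · intro t ht
    simp at ht
    simp [mem_lag, ht]
  · intro a _ b _ h
    exact (Prod.ext_iff.1 h).1
  · rintro ⟨t, b⟩ h
    simp [mem_lag] at h
    refine ⟨t, by simp [h.2], ?_⟩
    ext
    · rfl
    · simp only []
      by_cases hb : b = true
      · simp [hb, h.1.1 hb]
      · have : t ∉ P := fun h' => hb (h.1.2 h')
        simp [this] at *
        exact h.1

lemma card_lag (P : Finset (Fin n)) : (lag P).card = n := by
  have := card_lag_filter P (fun _ => True)
  simpa using this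

lemma lag_posF {A : Finset (JJ n)} (hA : AdmissibleSet A) (hc : A.card = n) :
    lag (posF A) = A := by
  symm
  apply Finset.eq_of_subset_of_card_le
  · rintro ⟨t, b⟩ hx
    have := hA _ hx
    cases b <;> simp_all [mem_lag, posF, starJ]
  · rw [card_lag, hc]

lemma lag_inj {P Q : Finset (Fin n)} (h : lag P = lag Q) : P = Q := by
  ext t
  have := congrArg ((t, true) ∈ ·) h
  simpa [mem_lag] using this

lemma mem_sd_lag (P Q : Finset (Fin n)) (x : JJ n) :
    x ∈ symmDiff (lag P) (lag Q) ↔ x.1 ∈ symmDiff P Q := by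
  rw [Finset.mem_symmDiff, mem_sd, mem_lag, mem_lag]
  tauto

lemma heightF_lag (P Q : Finset (Fin n)) : heightF (lag Q) (lag P) = (symmDiff P Q).card := by
  unfold heightF
  have : lag P ∩ lag Q = (lag P).filter (fun x => x.1 ∉ symmDiff P Q) := by
    ext x
    rw [Finset.mem_inter, Finset.mem_filter, mem_sd, mem_lag, mem_lag]
    tauto
  rw [this, card_lag_filter P (fun t => t ∉ symmDiff P Q)]
  have h2 := Finset.card_compl (symmDiff P Q)
  have h3 := Finset.card_le_univ (symmDiff P Q)
  have h4 : Finset.univ.filter (fun t => t ∉ symmDiff P Q) = (symmDiff P Q)ᶜ := by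
    ext t; simp only [Finset.mem_filter, Finset.mem_univ, true_and, Finset.mem_compl]
  rw [h4, h2]
  simp at h3 ⊢
  omega

/-- `±1` coordinate -/
noncomputable def eps (P : Finset (Fin n)) (t : Fin n) : ℝ := if t ∈ P then -1 else 1

lemma eps_sq (P : Finset (Fin n)) (t : Fin n) : eps P t * eps P t = 1 := by
  unfold eps; split_ifs <;> norm_num

lemma eSet_lag (P : Finset (Fin n)) (t : Fin n) : eSet (lag P) t = eps P t := by
  unfold eSet
  rw [Finset.sum_apply]
  rw [Finset.sum_eq_single ((t, decide (t ∈ P)) : JJ n)]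
  · simp [eVec, eps]
  · rintro ⟨u, b⟩ hx hne
    simp only [eVec]
    rw [if_neg]
    rintro rfl
    apply hne
    rw [mem_lag] at hx
    ext
    · rfl
    · simp only [] at hx ⊢
      by_cases h : t ∈ P <;> simp_all
  · intro h
    exfalso; apply h; simp [mem_lag]

lemma eps_sd (P T : Finset (Fin n)) (t : Fin n) :
    eps (symmDiff P T) t = eps P t - 2 * if t ∈ T then eps P t else 0 := by
  unfold eps
  by_cases h1 : t ∈ P <;> by_cases h2 : t ∈ T <;> simp [Finset.mem_symmDiff, h1, h2] <;> norm_num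

lemma L_lag (L : (Fin n → ℝ) →ₗ[ℝ] ℝ) (P : Finset (Fin n)) :
    L (eSet (lag P)) = ∑ t, L (Pi.single t 1) * eps P t := by
  have : eSet (lag P) = ∑ t, eps P t • (Pi.single t (1 : ℝ) : Fin n → ℝ) := by
    ext u
    rw [eSet_lag, Finset.sum_apply]
    simp [Pi.single_apply]
  rw [this, map_sum]
  refine Finset.sum_congr rfl (fun t _ => ?_)
  rw [map_smul, smul_eq_mul, mul_comm]

lemma L_sd (L : (Fin n → ℝ) →ₗ[ℝ] ℝ) (P T : Finset (Fin n)) :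
    L (eSet (lag (symmDiff P T))) =
      L (eSet (lag P)) - 2 * ∑ t ∈ T, L (Pi.single t 1) * eps P t := by
  rw [L_lag, L_lag]
  have : ∑ t ∈ T, L (Pi.single t 1) * eps P t =
      ∑ t, L (Pi.single t 1) * if t ∈ T then eps P t else 0 := by
    simp [Finset.sum_ite_mem]
  rw [this, Finset.mul_sum, ← Finset.sum_sub_distrib]
  refine Finset.sum_congr rfl (fun t _ => ?_)
  rw [eps_sd]; ring

lemma edge_of {ℬ : Finset (Finset (JJ n))} (hM : IsLagrangianMatroid ℬ) {P S : Finset (Fin n)}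
    (hP : lag P ∈ ℬ) (hS : lag (symmDiff P S) ∈ ℬ) (hne : S ≠ ∅) (c : Fin n → ℝ)
    (h0 : ∑ t ∈ S, c t = 0)
    (hpos : ∀ T, T ≠ ∅ → T ≠ S → lag (symmDiff P T) ∈ ℬ → 0 < ∑ t ∈ T, c t) :
    IsEdge ℬ (lag P) (lag (symmDiff P S)) := by
  refine ⟨hP, hS, ?_, ∑ t, (c t * eps P t) • LinearMap.proj t, ?_⟩
  · intro h
    have := lag_inj h
    exact hne (by simpa using this.symm)
  have key : ∀ T : Finset (Fin n), ∑ t ∈ T, (∑ u, (c u * eps P u) •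
      (LinearMap.proj u : (Fin n → ℝ) →ₗ[ℝ] ℝ)) (Pi.single t 1) * eps P t = ∑ t ∈ T, c t := by
    intro T
    refine Finset.sum_congr rfl (fun t _ => ?_)
    simp [Pi.single_apply, mul_assoc, eps_sq]
  constructor
  · rw [L_sd, key, h0]; ring
  · intro C hC n1 n2
    have eC := lag_posF (hM.1 C hC).1 (hM.1 C hC).2
    set R := posF C
    have eR : R = symmDiff P (symmDiff P R) := by simp
    have h5 := hpos (symmDiff P R) ?_ ?_ ?_
    · rw [← eC, eR, L_sd, key]; linarith
    · intro h; apply n1; rw [← eC, eR, h]; congr 1; ext; simp [Finset.mem_symmDiff]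
    · intro h; apply n2; rw [← eC, eR, h]
    · rw [← eR, eC]; exact hC

lemma edge_of_one {ℬ : Finset (Finset (JJ n))} (hM : IsLagrangianMatroid ℬ)
    {P : Finset (Fin n)} {i : Fin n}
    (hP : lag P ∈ ℬ) (hS : lag (symmDiff P {i}) ∈ ℬ) :
    IsEdge ℬ (lag P) (lag (symmDiff P {i})) := by
  refine edge_of hM hP hS (by simp) (fun t => if t = i then 0 else 1) (by simp) ?_
  intro T h1 h2 _
  obtain ⟨u, hu, hui⟩ : ∃ u ∈ T, u ≠ i := by
    by_contra hcon
    push Not at hcon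
    have : T ⊆ {i} := fun t ht => by simp [hcon t ht]
    rcases Finset.subset_singleton_iff.1 this with h | h
    · exact h1 h
    · exact h2 h
  refine Finset.sum_pos' (fun t _ => by split_ifs <;> norm_num) ⟨u, hu, by simp [hui]⟩

lemma edge_of_two {ℬ : Finset (Finset (JJ n))} (hM : IsLagrangianMatroid ℬ)
    {P : Finset (Fin n)} {i j : Fin n} (hij : i ≠ j)
    (hP : lag P ∈ ℬ) (hS : lag (symmDiff P {i, j}) ∈ ℬ) (hn : lag (symmDiff P {i}) ∉ ℬ) :
    IsEdge ℬ (lag P) (lag (symmDiff P {i, j})) := by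
  refine edge_of hM hP hS (by simp) (fun t => if t = i then -1 else if t = j then 1 else 3) ?_ ?_
  · rw [Finset.sum_pair hij]; simp [hij.symm]
  intro T h1 h2 h3
  by_cases hT : ∃ u ∈ T, u ≠ i ∧ u ≠ j
  · obtain ⟨u, hu, hui, huj⟩ := hT
    have hle : ∑ t ∈ T.erase i, (if t = i then (-1 : ℝ) else if t = j then 1 else 3) ≥ 3 := by
      have := Finset.single_le_sum
        (f := fun t => if t = i then (-1 : ℝ) else if t = j then 1 else 3) (s := T.erase i)
        (fun t ht => by
          have := (Finset.mem_erase.1 ht).1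
          simp only [this, if_false]; split_ifs <;> norm_num) (Finset.mem_erase.2 ⟨hui, hu⟩)
      simpa [hui, huj] using this
    by_cases hi : i ∈ T
    · rw [← Finset.add_sum_erase T _ hi]
      simp only [if_true]; linarith
    · rw [Finset.erase_eq_of_notMem hi] at hle
      linarith
  · push Not at hT
    have hiT : T ≠ {i} := by rintro rfl; exact hn h3
    have : T = {j} := by
      ext t
      simp only [Finset.mem_singleton]
      have hj : j ∈ T := by
        by_contra hj
        apply hiT
        obtain ⟨u, hu⟩ := Finset.nonempty_iff_ne_empty.2 h1
        ext t
        simp only [Finset.mem_singleton]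
        grind
      constructor
      · intro ht
        by_contra htj
        apply h2
        ext u
        simp only [Finset.mem_insert, Finset.mem_singleton]
        grind
      · rintro rfl; exact hj
    rw [this]; simp [hij.symm]

/-- Symmetric exchange. -/
lemma exch {ℬ : Finset (Finset (JJ n))} (hM : IsLagrangianMatroid ℬ)
    {X Y : Finset (Fin n)} (hX : lag X ∈ ℬ) (hY : lag Y ∈ ℬ) {k : Fin n}
    (hk : k ∈ symmDiff X Y) : ∃ j ∈ symmDiff X Y, lag (symmDiff X {k, j}) ∈ ℬ := by
  obtain ⟨T, hT, hmin⟩ := Finset.exists_min_image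
    ((symmDiff X Y).powerset.filter (fun T => k ∈ T ∧ lag (symmDiff X T) ∈ ℬ)) Finset.card
    ⟨symmDiff X Y, by simp [hY]; exact hk⟩
  rw [Finset.mem_filter, Finset.mem_powerset] at hT
  obtain ⟨hTS, hkT, hTB⟩ := hT
  have hT2 : T.card ≤ 2 := by
    set lv : Fin n → ℕ := fun t => if t = k then 1 else if t ∈ T then 0 else 2 with hlv
    set τ := Tuple.sort lv with hτ
    have hmono : Monotone (lv ∘ τ) := Tuple.monotone_sort lv
    set Pf := symmDiff X {k} with hPf
    let w : Equiv.Perm (JJ n) :=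
      { toFun := fun y => (τ y.1, xor y.2 (decide (τ y.1 ∈ Pf)))
        invFun := fun x => (τ.symm x.1, xor x.2 (decide (x.1 ∈ Pf)))
        left_inv := by rintro ⟨t, b⟩; simp
        right_inv := by rintro ⟨t, b⟩; simp }
    have hw : AdmissiblePerm w := by
      rintro ⟨t, b⟩
      simp [w, starJ]
    obtain ⟨A, hA, hmax⟩ := hM.2 w hw
    have eA := lag_posF (hM.1 A hA).1 (hM.1 A hA).2
    set Z := posF A
    have hord : ∀ x y : JJ n, ∀ l, leW w x y → x ∈ lag Pf → l ≤ lv x.1 →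
        y ∈ lag Pf ∧ l ≤ lv y.1 := by
      rintro ⟨t, b⟩ ⟨u, c⟩ l hle hx hl
      rw [mem_lag] at hx ⊢
      simp only [] at hx hl ⊢
      have e1 : w.symm (t, b) = (τ.symm t, false) := by
        simp only [w, Equiv.coe_fn_symm_mk]
        by_cases h : t ∈ Pf <;> simp_all
      unfold leW at hle
      rw [e1] at hle
      by_cases hy : (c = true ↔ u ∈ Pf)
      · have e2 : w.symm (u, c) = (τ.symm u, false) := by
          simp only [w, Equiv.coe_fn_symm_mk]
          by_cases h : u ∈ Pf <;> simp_all
        rw [e2] at hle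
        simp [ordJ] at hle
        have h5 := hmono (show τ.symm t ≤ τ.symm u by exact_mod_cast hle)
        simp only [Function.comp, Equiv.apply_symm_apply] at h5
        exact ⟨hy, hl.trans h5⟩
      · exfalso
        have e2 : w.symm (u, c) = (τ.symm u, true) := by
          simp only [w, Equiv.coe_fn_symm_mk]
          by_cases h : u ∈ Pf <;> simp_all
        rw [e2] at hle
        simp [ordJ] at hle
        omega
    have hcard : ∀ (R : Finset (Fin n)) (l : ℕ),
        ((lag R).filter (fun x => x ∈ lag Pf ∧ l ≤ lv x.1)).card =
        (Finset.univ.filter (fun t => (t ∈ R ↔ t ∈ Pf) ∧ l ≤ lv t)).card := by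
      intro R l
      rw [← card_lag_filter R (fun t => (t ∈ R ↔ t ∈ Pf) ∧ l ≤ lv t)]
      congr 1
      ext x
      simp only [Finset.mem_filter, mem_lag]
      tauto
    have hineq : ∀ (R : Finset (Fin n)) (l : ℕ), lag R ∈ ℬ →
        (Finset.univ.filter (fun t => (t ∈ R ↔ t ∈ Pf) ∧ l ≤ lv t)).card ≤
        (Finset.univ.filter (fun t => (t ∈ Z ↔ t ∈ Pf) ∧ l ≤ lv t)).card := by
      intro R l hR
      rw [← hcard, ← hcard]
      obtain ⟨f, hf, hle⟩ := hmax _ hR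
      rw [← eA] at hf
      refine Finset.card_le_card_of_injOn f ?_ ?_
      · intro x hx
        simp only [Finset.coe_filter, Set.mem_ofPred_eq] at hx ⊢
        exact ⟨hf.mapsTo hx.1, hord x (f x) l (hle x hx.1) hx.2.1 hx.2.2⟩
      · exact hf.injOn.mono (fun x hx => (Finset.mem_filter.1 hx).1)
    have l2 : ∀ t, 2 ≤ lv t ↔ t ∉ T := by
      intro t; simp only [hlv]
      by_cases h1 : t = k
      · subst h1; simp [hkT]
      · by_cases h2 : t ∈ T <;> simp [h1, h2]
    have l1 : ∀ t, 1 ≤ lv t ↔ (t ∉ T ∨ t = k) := by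
      intro t; simp only [hlv]
      by_cases h1 : t = k
      · subst h1; simp
      · by_cases h2 : t ∈ T <;> simp [h1, h2]
    have mPf : ∀ t, t ∈ Pf ↔ ¬ (t ∈ X ↔ t = k) := fun t => mem_flip X k t
    have full : ∀ (R : Finset (Fin n)) (l : ℕ), lag R ∈ ℬ → (∀ t, l ≤ lv t → (t ∈ R ↔ t ∈ Pf)) →
        ∀ t, l ≤ lv t → (t ∈ Z ↔ t ∈ Pf) := by
      intro R l hR hall t ht
      have h1 := hineq R l hR
      have h2 : (Finset.univ.filter (fun t => (t ∈ Z ↔ t ∈ Pf) ∧ l ≤ lv t)) =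
          (Finset.univ.filter (fun t => (t ∈ R ↔ t ∈ Pf) ∧ l ≤ lv t)) := by
        apply Finset.eq_of_subset_of_card_le _ h1
        intro u hu
        rw [Finset.mem_filter] at hu ⊢
        exact ⟨hu.1, hall u hu.2.2, hu.2.2⟩
      have h3 : t ∈ (Finset.univ.filter (fun t => (t ∈ R ↔ t ∈ Pf) ∧ l ≤ lv t)) := by
        rw [Finset.mem_filter]; exact ⟨Finset.mem_univ _, hall t ht, ht⟩
      rw [← h2, Finset.mem_filter] at h3
      exact h3.2.1
    have z1 := full (symmDiff X T) 1 hTB (by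
      intro t ht
      rw [l1] at ht
      rw [mPf, mem_sd]
      rcases ht with ht | rfl
      · have : t ≠ k := by rintro rfl; exact ht hkT
        tauto
      · tauto)
    have hZ : Z = symmDiff X T := by
      have hT' : symmDiff X Z ⊆ T := by
        intro t ht
        by_contra htT
        have := z1 t ((l1 t).2 (Or.inl htT))
        have h5 : t ≠ k := by rintro rfl; exact htT hkT
        rw [mPf] at this
        rw [mem_sd] at ht
        tauto
      have hkT' : k ∈ symmDiff X Z := by
        have := z1 k ((l1 k).2 (Or.inr rfl))
        rw [mPf] at this
        rw [mem_sd]; tauto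
      have := hmin (symmDiff X Z) (by
        rw [Finset.mem_filter, Finset.mem_powerset]
        refine ⟨hT'.trans hTS, hkT', ?_⟩
        simp [eA, hA])
      rw [← Finset.eq_of_subset_of_card_le hT' this]; simp
    have h0 := hineq X 0 hX
    have h01 : (Finset.univ.filter (fun t => (t ∈ X ↔ t ∈ Pf) ∧ 0 ≤ lv t)) =
        Finset.univ.erase k := by
      ext t; simp [mPf]; tauto
    have h02 : (Finset.univ.filter (fun t => (t ∈ Z ↔ t ∈ Pf) ∧ 0 ≤ lv t)) ⊆ insert k Tᶜ := by
      intro t; rw [hZ]; simp [mPf, Finset.mem_symmDiff]; tauto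
    have h03 := (Finset.card_le_card h02).trans (Finset.card_insert_le _ _)
    rw [h01, Finset.card_erase_of_mem (Finset.mem_univ k)] at h0
    rw [Finset.card_compl] at h03
    have := Finset.card_le_univ T
    have hn := Finset.card_le_univ ({k} : Finset (Fin n))
    simp at *
    omega
  by_cases h1 : T = {k}
  · exact ⟨k, hk, by rw [h1] at hTB; simpa using hTB⟩
  · obtain ⟨j, hj, hjk⟩ : ∃ j ∈ T, j ≠ k := by
      by_contra hcon
      push Not at hcon
      apply h1
      ext t; simp only [Finset.mem_singleton]
      exact ⟨hcon t, fun h => h ▸ hkT⟩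
    refine ⟨j, hTS hj, ?_⟩
    have : {k, j} = T := by
      apply Finset.eq_of_subset_of_card_le
      · intro t; simp only [Finset.mem_insert, Finset.mem_singleton]
        rintro (rfl | rfl) <;> assumption
      · rw [Finset.card_pair hjk.symm]; exact hT2
    rw [this]; exact hTB

end Trans

section Trans2
variable {n : ℕ}

lemma edge_dist_aux {ℬ : Finset (Finset (JJ n))} (hM : IsLagrangianMatroid ℬ)
    {P Q : Finset (Fin n)} (hP : lag P ∈ ℬ) (hQ : lag Q ∈ ℬ) (L : (Fin n → ℝ) →ₗ[ℝ] ℝ)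
    (hlt : ∀ C ∈ ℬ, C ≠ lag P → C ≠ lag Q → L (eSet C) < L (eSet (lag P)))
    (h3 : 3 ≤ (symmDiff P Q).card) {k : Fin n} (hk : k ∈ symmDiff P Q)
    (hmax : ∀ t ∈ symmDiff P Q, |L (Pi.single t 1)| ≤ |L (Pi.single k 1)|)
    (hneg : L (Pi.single k 1) * eps P k ≤ 0) : False := by
  obtain ⟨j, hj, hB⟩ := exch hM hP hQ hk
  have h1 := hlt _ hB (by
    intro h
    have := lag_inj h
    have h2 : k ∈ symmDiff P {k, j} ↔ k ∈ P := by rw [this]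
    rw [mem_flip2] at h2
    tauto) (by
    intro h
    have := lag_inj h
    rw [← this] at h3
    simp only [symmDiff_symmDiff_cancel_left] at h3
    have := Finset.card_le_two (a := k) (b := j)
    omega)
  rw [L_sd] at h1
  have ab : ∀ t, |L (Pi.single t 1) * eps P t| = |L (Pi.single t 1)| := by
    intro t
    rw [abs_mul]
    have : |eps P t| = 1 := by unfold eps; split_ifs <;> simp
    rw [this, mul_one]
  by_cases hjk : k = j
  · subst hjk
    simp at h1
    linarith
  · rw [Finset.sum_pair hjk] at h1
    have h5 := hmax j hj
    rw [← ab j, ← ab k, abs_of_nonpos hneg] at h5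
    have := le_abs_self (L (Pi.single j 1) * eps P j)
    linarith

lemma edge_dist {ℬ : Finset (Finset (JJ n))} (hM : IsLagrangianMatroid ℬ)
    {P Q : Finset (Fin n)} (hE : IsEdge ℬ (lag P) (lag Q)) : (symmDiff P Q).card ≤ 2 := by
  obtain ⟨hP, hQ, hne, L, heq, hlt⟩ := hE
  by_contra hcon
  have h3 : 3 ≤ (symmDiff P Q).card := by omega
  obtain ⟨k, hk, hmax⟩ := Finset.exists_max_image (symmDiff P Q) (fun t => |L (Pi.single t 1)|)
    (Finset.card_pos.1 (by omega))
  by_cases hneg : L (Pi.single k 1) * eps P k ≤ 0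
  · exact edge_dist_aux hM hP hQ L hlt h3 hk hmax hneg
  · rw [symmDiff_comm] at hk h3
    refine edge_dist_aux hM hQ hP L ?_ h3 hk ?_ ?_
    · intro C hC h1 h2
      rw [← heq]; exact hlt C hC h2 h1
    · rw [symmDiff_comm]; exact hmax
    · have : eps Q k = - eps P k := by
        rw [mem_sd] at hk
        unfold eps
        split_ifs <;> first | tauto | simp
      rw [this]
      push Not at hneg
      linarith

lemma edge_two {ℬ : Finset (Finset (JJ n))} {P : Finset (Fin n)} {i j : Fin n} (hij : i ≠ j)
    (hE : IsEdge ℬ (lag P) (lag (symmDiff P {i, j}))) :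
    ¬ (lag (symmDiff P {i}) ∈ ℬ ∧ lag (symmDiff P {j}) ∈ ℬ) := by
  rintro ⟨h1, h2⟩
  obtain ⟨hP, hQ, hne, L, heq, hlt⟩ := hE
  have a1 := hlt _ h1 (by
    intro h
    have h2 : i ∈ symmDiff P {i} ↔ i ∈ P := by rw [lag_inj h]
    rw [mem_flip] at h2; tauto) (by
    intro h
    have h2 : j ∈ symmDiff P {i} ↔ j ∈ symmDiff P {i, j} := by rw [lag_inj h]
    rw [mem_flip, mem_flip2] at h2
    have := hij.symm; tauto)
  have a2 := hlt _ h2 (by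
    intro h
    have h2 : j ∈ symmDiff P {j} ↔ j ∈ P := by rw [lag_inj h]
    rw [mem_flip] at h2; tauto) (by
    intro h
    have h2 : i ∈ symmDiff P {j} ↔ i ∈ symmDiff P {i, j} := by rw [lag_inj h]
    rw [mem_flip, mem_flip2] at h2
    tauto)
  rw [L_sd] at a1 a2 heq
  rw [Finset.sum_pair hij] at heq
  simp only [Finset.sum_singleton] at a1 a2
  linarith

lemma sd_one (P Q : Finset (Fin n)) (i : JJ n) :
    symmDiff (lag P) (lag Q) = ({i, starJ i} : Finset (JJ n)) ↔ symmDiff P Q = {i.1} := by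
  have key : ∀ x : JJ n, x ∈ ({i, starJ i} : Finset (JJ n)) ↔ x.1 = i.1 := by
    rintro ⟨t, b⟩
    obtain ⟨u, c⟩ := i
    cases b <;> cases c <;> simp [starJ]
  constructor
  · intro h
    ext t
    rw [← mem_sd_lag P Q (t, true), h, key]; simp
  · intro h
    ext x
    rw [mem_sd_lag, h, key]; simp

lemma sd_two (P Q : Finset (Fin n)) (i j : JJ n) :
    symmDiff (lag P) (lag Q) = ({i, starJ i, j, starJ j} : Finset (JJ n)) ↔
      symmDiff P Q = {i.1, j.1} := by
  have key : ∀ x : JJ n, x ∈ ({i, starJ i, j, starJ j} : Finset (JJ n)) ↔ x.1 = i.1 ∨ x.1 = j.1 := by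
    rintro ⟨t, b⟩
    obtain ⟨u, c⟩ := i
    obtain ⟨u', c'⟩ := j
    cases b <;> cases c <;> cases c' <;> simp [starJ]
  constructor
  · intro h
    ext t
    rw [← mem_sd_lag P Q (t, true), h, key]; simp
  · intro h
    ext x
    rw [mem_sd_lag, h, key]; simp

lemma short_iff {ℬ : Finset (Finset (JJ n))} {P Q : Finset (Fin n)} :
    IsShortEdge ℬ (lag P) (lag Q) ↔ IsEdge ℬ (lag P) (lag Q) ∧ (symmDiff P Q).card = 1 := by
  unfold IsShortEdge
  refine and_congr_right (fun _ => ?_)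
  rw [Finset.card_eq_one]
  constructor
  · rintro ⟨i, h⟩
    exact ⟨i.1, (sd_one _ _ _).1 h⟩
  · rintro ⟨i, h⟩
    exact ⟨(i, false), (sd_one _ _ _).2 h⟩

lemma long_iff {ℬ : Finset (Finset (JJ n))} {P Q : Finset (Fin n)} :
    IsLongEdge ℬ (lag P) (lag Q) ↔ IsEdge ℬ (lag P) (lag Q) ∧ (symmDiff P Q).card = 2 := by
  unfold IsLongEdge
  refine and_congr_right (fun _ => ?_)
  rw [Finset.card_eq_two]
  constructor
  · rintro ⟨i, j, h1, h2, h⟩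
    refine ⟨i.1, j.1, ?_, (sd_two _ _ _ _).1 h⟩
    intro h3
    obtain ⟨u, c⟩ := i
    obtain ⟨u', c'⟩ := j
    simp only [] at h3
    subst h3
    cases c <;> cases c' <;> simp [starJ] at h1 h2
  · rintro ⟨i, j, hij, h⟩
    refine ⟨(i, false), (j, false), ?_, ?_, (sd_two _ _ _ _).2 h⟩
    · intro h; exact hij (Prod.ext_iff.1 h).1
    · intro h; exact hij (Prod.ext_iff.1 h).1

/-- The basis with twisted coordinates `T` relative to `Q`. -/
noncomputable def tw (Q T : Finset (Fin n)) : Finset (JJ n) := lag (symmDiff T Q)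

lemma height_tw (Q T : Finset (Fin n)) : heightF (lag Q) (tw Q T) = T.card := by
  rw [tw, heightF_lag]; simp

lemma tw_sd (Q X T : Finset (Fin n)) : tw Q (symmDiff X T) = lag (symmDiff (symmDiff X Q) T) := by
  rw [tw, symmDiff_right_comm]

lemma sd_tw (Q X Y : Finset (Fin n)) :
    symmDiff (symmDiff X Q) (symmDiff Y Q) = symmDiff X Y := by
  ext t; simp only [mem_sd]; tauto

lemma tw_edge_two {ℬ : Finset (Finset (JJ n))} (hM : IsLagrangianMatroid ℬ)
    {Q X : Finset (Fin n)} {i j : Fin n} (hij : i ≠ j)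
    (hX : tw Q X ∈ ℬ) (hZ : tw Q (symmDiff X {i, j}) ∈ ℬ)
    (hn : ¬ (tw Q (symmDiff X {i}) ∈ ℬ ∧ tw Q (symmDiff X {j}) ∈ ℬ)) :
    IsEdge ℬ (tw Q X) (tw Q (symmDiff X {i, j})) := by
  rw [not_and_or] at hn
  rw [tw_sd] at hZ ⊢
  rw [tw_sd, tw_sd] at hn
  rcases hn with hn | hn
  · exact edge_of_two hM hij hX hZ hn
  · rw [Finset.pair_comm] at hZ ⊢
    exact edge_of_two hM hij.symm hX hZ hn

lemma sdm_of {ℬ : Finset (Finset (JJ n))} (hM : IsLagrangianMatroid ℬ)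
    (Q : Finset (Fin n)) (sF : Finset (JJ n) → ℤ) (ho : IsOrientationRel ℬ (lag Q) sF) :
    SDM (fun T => tw Q T ∈ ℬ) (fun T => sF (tw Q T)) := by
  obtain ⟨o1, o2, o3, o4, -⟩ := ho
  refine ⟨?_, fun X hX => o1 _ hX, ?_, ?_⟩
  · intro X Y hX hY k hk
    obtain ⟨j, hj, h⟩ := exch hM (k := k) hX hY (by rw [sd_tw]; exact hk)
    rw [sd_tw] at hj
    exact ⟨j, hj, by rw [tw_sd]; exact h⟩
  · intro X i j hij hX hZ hn
    have hE := tw_edge_two hM hij hX hZ hn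
    have hL : IsLongEdge ℬ (tw Q X) (tw Q (symmDiff X {i, j})) := by
      unfold tw at hE ⊢
      rw [long_iff]
      refine ⟨hE, ?_⟩
      rw [sd_tw]; simp [Finset.card_pair hij]
    have hc := card_flip2 X i j hij
    have hh := o2 _ _ hL
    have hv := o3 _ _ hL
    rw [height_tw, height_tw] at hh hv
    show sF _ = if _ then - sF _ else sF _
    by_cases h1 : i ∈ X <;> by_cases h2 : j ∈ X <;> simp only [h1, h2, if_true, if_false] at hc ⊢
    · rw [hv (by omega)]; ring
    · simp
      rw [hh (by omega)]
    · simp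
      rw [hh (by omega)]
    · rw [hv (by omega)]; ring
  · intro X i j hij hX hZ hi hj
    have hsq : ShortSquare ℬ ![tw Q X, tw Q (symmDiff X {i}), tw Q (symmDiff X {j}),
        tw Q (symmDiff X {i, j})] := by
      refine ⟨tw Q X, (i, false), (j, false), hij, rfl, ?_, ?_, ?_, ?_⟩
      · show tw Q (symmDiff X {i}) = _
        have := (sd_one (symmDiff X Q) (symmDiff (symmDiff X {i}) Q) (i, false)).2
          (by rw [sd_tw]; simp)
        rw [← this]; simp [tw]
      · show tw Q (symmDiff X {j}) = _
        have := (sd_one (symmDiff X Q) (symmDiff (symmDiff X {j}) Q) (j, false)).2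
          (by rw [sd_tw]; simp)
        rw [← this]; simp [tw]
      · show tw Q (symmDiff X {i, j}) = _
        have := (sd_two (symmDiff X Q) (symmDiff (symmDiff X {i, j}) Q) (i, false) (j, false)).2
          (by rw [sd_tw]; simp)
        rw [← this]; simp [tw]
      · intro k
        fin_cases k
        · exact hX
        · exact hi
        · exact hj
        · exact hZ
    have hax := o4 _ hsq
    have c2 := card_flip2 X i j hij
    have ci := card_flip X i
    have cj := card_flip X j
    have q0 := hax 0
    have q1 := hax 1
    have q2 := hax 2
    have q3 := hax 3
    clear hax
    simp only [Fin.forall_fin_succ, Fin.exists_fin_succ] at q0 q1 q2 q3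
    simp [height_tw] at q0 q1 q2 q3
    have p0 := o1 _ hX
    have p1 := o1 _ hi
    have p2 := o1 _ hj
    have p3 := o1 _ hZ
    generalize sF (tw Q X) = a0 at *
    generalize sF (tw Q (symmDiff X {i})) = a1 at *
    generalize sF (tw Q (symmDiff X {j})) = a2 at *
    generalize sF (tw Q (symmDiff X {i, j})) = a3 at *
    show if _ then (a0 = a3 → a1 = a2) else (a1 = a2 → a0 = a3)
    by_cases h1 : i ∈ X <;> by_cases h2 : j ∈ X <;>
      simp only [h1, h2, if_true, if_false, iff_self, iff_true, iff_false, not_true] at c2 ci cj ⊢ <;>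
      rcases p0 with rfl | rfl <;> rcases p1 with rfl | rfl <;>
      rcases p2 with rfl | rfl <;> rcases p3 with rfl | rfl <;>
      simp at q0 q1 q2 q3 ⊢ <;> omega

end Trans2

section Trans3
variable {n : ℕ}

lemma card_tw_diff (Q X Y : Finset (Fin n)) :
    (tw Q Y \ (lag Q ∪ tw Q X)).card = (Y \ X).card := by
  have h : tw Q Y \ (lag Q ∪ tw Q X) = (tw Q Y).filter (fun x => x.1 ∈ Y \ X) := by
    ext x
    simp only [Finset.mem_sdiff, Finset.mem_union, Finset.mem_filter, tw, mem_lag, mem_sd]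
    tauto
  rw [h, tw, card_lag_filter _ (fun t => t ∈ Y \ X)]
  congr 1
  ext t
  simp only [Finset.mem_filter, Finset.mem_univ, true_and]

lemma edge_step {ℬ : Finset (Finset (JJ n))} (hM : IsLagrangianMatroid ℬ)
    {s : Finset (JJ n) → Finset (JJ n) → ℤ} (hs : IsOrientation ℬ s)
    {Q : Finset (Fin n)} (hF : lag Q ∈ ℬ) {X Y : Finset (Fin n)}
    (hE : IsEdge ℬ (tw Q X) (tw Q Y)) (hle : X.card ≤ Y.card) :
    (2 * (if s (lag Q) (tw Q X) ≠ s (lag Q) (tw Q Y) then 1 else 0) : ℤ) =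
      DD (fun T => tw Q T ∈ ℬ) (fun T => s (lag Q) (tw Q T)) X Y + Y.card - X.card ∧
    (IsInducingEdgeS ℬ s (lag Q) (tw Q X) (tw Q Y) ↔
      s (lag Q) (tw Q X) ≠ s (lag Q) (tw Q Y)) := by
  have H := sdm_of hM Q (s (lag Q)) (hs.2.1 _ hF)
  have hX := hE.1
  have hY := hE.2.1
  have pX := H.pm X hX
  have pY := H.pm Y hY
  have hd : (symmDiff X Y).card ≤ 2 := by
    have := edge_dist hM hE
    rwa [sd_tw] at this
  have hSh : IsShortEdge ℬ (tw Q X) (tw Q Y) ↔ (symmDiff X Y).card = 1 := by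
    unfold tw at hE ⊢
    rw [short_iff, sd_tw]
    exact and_iff_right hE
  have hLo : IsLongEdge ℬ (tw Q X) (tw Q Y) ↔ (symmDiff X Y).card = 2 := by
    unfold tw at hE ⊢
    rw [long_iff, sd_tw]
    exact and_iff_right hE
  have hcb := hs.2.2 _ hY _ hF _ hX
  rw [card_tw_diff] at hcb
  unfold IsInducingEdgeS
  rw [hSh, hLo, height_tw, height_tw]
  have h0 : (symmDiff X Y).card ≠ 0 := by
    intro h
    rw [Finset.card_eq_zero] at h
    have : X = Y := symmDiff_eq_bot.1 h
    exact hE.2.2.1 (by rw [this])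
  rcases (show (symmDiff X Y).card = 1 ∨ (symmDiff X Y).card = 2 by omega) with h1 | h2
  · obtain ⟨i, hi⟩ := Finset.card_eq_one.1 h1
    have eY := eq_flip_of_sd hi
    have hc := card_flip X i
    have hdd := DD_flip (Fe := fun T => tw Q T ∈ ℬ) (σ := fun T => s (lag Q) (tw Q T)) X i
    rw [← eY] at hc hdd
    have hiX : i ∉ X := by
      intro h
      simp only [h, if_true] at hc
      omega
    simp only [hiX, if_false] at hc hdd
    have e1 : Y \ X = {i} := by
      ext t
      rw [eY, Finset.mem_sdiff, mem_flip, Finset.mem_singleton]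
      constructor
      · tauto
      · rintro rfl; tauto
    rw [e1] at hcb
    simp only [Finset.card_singleton, pow_one] at hcb
    rw [hdd, h1, hcb]
    have l1 : X.card < Y.card := by omega
    have l2 : ¬ (Y.card < X.card) := by omega
    simp only [l1, l2]
    rcases pX with pX | pX <;> rcases pY with pY | pY <;> rw [pX, pY] <;> norm_num <;> omega
  · obtain ⟨i, j, hij, hi⟩ := Finset.card_eq_two.1 h2
    have eY := eq_flip_of_sd hi
    have hE2 := hE
    have hc := card_flip2 X i j hij
    have hn : ¬ (tw Q (symmDiff X {i}) ∈ ℬ ∧ tw Q (symmDiff X {j}) ∈ ℬ) := by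
      rw [eY, tw_sd] at hE2
      rw [tw_sd, tw_sd]
      exact edge_two hij hE2
    have hdd : DD (fun T => tw Q T ∈ ℬ) (fun T => s (lag Q) (tw Q T)) X Y = 0 := by
      rw [not_and_or] at hn
      rcases hn with hn | hn
      · exact DD_zero h2 (t := i) (by rw [hi]; simp) hn
      · exact DD_zero h2 (t := j) (by rw [hi]; simp) hn
    have hl := H.long X i j hij hX (by rw [← eY]; exact hY) hn
    rw [← eY] at hc hl
    rw [hdd, h2]
    rw [hl]
    by_cases m1 : i ∈ X <;> by_cases m2 : j ∈ X <;> simp only [m1, m2, if_true, if_false] at hc ⊢ <;>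
      rcases pX with pX | pX <;> rw [pX] <;> norm_num <;> omega

lemma path_sum {ℬ : Finset (Finset (JJ n))} (hM : IsLagrangianMatroid ℬ)
    {s : Finset (JJ n) → Finset (JJ n) → ℤ} (hs : IsOrientation ℬ s)
    {Q : Finset (Fin n)} (hF : lag Q ∈ ℬ) (x : ℕ → Finset (Fin n)) (h0 : tw Q (x 0) ∈ ℬ) (p : ℕ)
    (hE : ∀ i < p, IsEdge ℬ (tw Q (x i)) (tw Q (x (i + 1))))
    (hle : ∀ i < p, (x i).card ≤ (x (i + 1)).card) :
    (2 * (((Finset.range p).filter fun i =>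
      s (lag Q) (tw Q (x i)) ≠ s (lag Q) (tw Q (x (i + 1)))).card : ℤ)) =
      DD (fun T => tw Q T ∈ ℬ) (fun T => s (lag Q) (tw Q T)) (x 0) (x p) +
        (x p).card - (x 0).card := by
  have H := sdm_of hM Q (s (lag Q)) (hs.2.1 _ hF)
  induction p with
  | zero => simp [DD_self]
  | succ p ih =>
    have ih' := ih (fun i hi => hE i (by omega)) (fun i hi => hle i (by omega))
    have st := (edge_step hM hs hF (hE p (by omega)) (hle p (by omega))).1
    have c := coc H h0 (hE p (by omega)).1 (hE p (by omega)).2.1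
    rw [Finset.range_add_one, Finset.filter_insert]
    split_ifs with hne
    · rw [Finset.card_insert_of_notMem (by simp)]
      rw [if_pos hne] at st
      push_cast
      linarith
    · rw [if_neg hne] at st
      linarith

end Trans3

/-- The index of an oriented Lagrangian matroid `(ℬ, s)` relative to
`F` (the number of sign changes along any increasing path from `F` to a basis of
maximal height) equals the number of inducing edges in any path of edges of the matroid
polytope from `F` to a basis of maximal height along which the height never
decreases. -/
theorem index_counts_inducing_edges {n : ℕ}
    (ℬ : Finset (Finset (JJ n))) (hM : IsLagrangianMatroid ℬ)
    (s : Finset (JJ n) → Finset (JJ n) → ℤ) (hs : IsOrientation ℬ s)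
    (F : Finset (JJ n)) (hF : F ∈ ℬ)
    (v : ℕ → Finset (JJ n)) (p : ℕ) (hv0 : v 0 = F)
    (hv : ∀ i < p, IsEdge ℬ (v i) (v (i + 1)) ∧ heightF F (v i) ≤ heightF F (v (i + 1)))
    (hvmax : MaxHeightBasis ℬ F (v p))
    (w : ℕ → Finset (JJ n)) (q : ℕ)
    (hw : IncreasingPath ℬ F w q) (hwmax : MaxHeightBasis ℬ F (w q)) :
    signChanges (s F) w q =
      ((Finset.range p).filter fun i => IsInducingEdgeS ℬ s F (v i) (v (i + 1))).card := by
  obtain ⟨hw0, hwE, L, hL1, hL2⟩ := hw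
  have eF := lag_posF (hM.1 F hF).1 (hM.1 F hF).2
  set Q := posF F with hQ
  rw [← eF] at hF hv hvmax hwmax hL1 hv0 hw0 ⊢
  have H := sdm_of hM Q (s (lag Q)) (hs.2.1 _ hF)
  have hB : ∀ A ∈ ℬ, tw Q (symmDiff (posF A) Q) = A := by
    intro A hA
    rw [tw]
    simp [lag_posF (hM.1 A hA).1 (hM.1 A hA).2]
  have memv : ∀ i ≤ p, v i ∈ ℬ := by
    intro i hi
    rcases Nat.lt_or_ge i p with h | h
    · exact (hv i h).1.1
    · rw [show i = p by omega]; exact hvmax.1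
  have memw : ∀ i ≤ q, w i ∈ ℬ := by
    intro i hi
    rcases Nat.lt_or_ge i q with h | h
    · exact (hwE i h).1
    · rw [show i = q by omega]; exact hwmax.1
  have hgt : ∀ A ∈ ℬ, heightF (lag Q) A = (symmDiff (posF A) Q).card := by
    intro A hA
    conv_lhs => rw [← hB A hA]
    exact height_tw _ _
  have Ev : ∀ i < p, IsEdge ℬ (tw Q (symmDiff (posF (v i)) Q))
      (tw Q (symmDiff (posF (v (i + 1))) Q)) := by
    intro i hi
    rw [hB _ (memv i (by omega)), hB _ (memv (i + 1) (by omega))]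
    exact (hv i hi).1
  have Lv : ∀ i < p, (symmDiff (posF (v i)) Q).card ≤ (symmDiff (posF (v (i + 1))) Q).card := by
    intro i hi
    rw [← hgt _ (memv i (by omega)), ← hgt _ (memv (i + 1) (by omega))]
    exact (hv i hi).2
  have Ew : ∀ i < q, IsEdge ℬ (tw Q (symmDiff (posF (w i)) Q))
      (tw Q (symmDiff (posF (w (i + 1))) Q)) := by
    intro i hi
    rw [hB _ (memw i (by omega)), hB _ (memw (i + 1) (by omega))]
    exact hwE i hi
  have Lw : ∀ i < q, (symmDiff (posF (w i)) Q).card ≤ (symmDiff (posF (w (i + 1))) Q).card := by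
    intro i hi
    rw [← hgt _ (memw i (by omega)), ← hgt _ (memw (i + 1) (by omega))]
    by_contra hcon
    push Not at hcon
    have h1 := hL1 _ (memw i (by omega)) _ (memw (i + 1) (by omega)) hcon
    have h2 := hL2 i hi
    linarith
  have bv0 := hB _ (memv 0 (by omega))
  have bw0 := hB _ (memw 0 (by omega))
  have sv := path_sum hM hs hF (fun i => symmDiff (posF (v i)) Q)
    (by rw [bv0]; exact memv 0 (by omega)) p Ev Lv
  have sw := path_sum hM hs hF (fun i => symmDiff (posF (w i)) Q)
    (by rw [bw0]; exact memw 0 (by omega)) q Ew Lw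
  have hvp := hB _ (memv p le_rfl)
  have hwq := hB _ (memw q le_rfl)
  have feV : tw Q (symmDiff (posF (v p)) Q) ∈ ℬ := by rw [hvp]; exact memv p le_rfl
  have feW : tw Q (symmDiff (posF (w q)) Q) ∈ ℬ := by rw [hwq]; exact memw q le_rfl
  have fe0 : tw Q (symmDiff (posF (w 0)) Q) ∈ ℬ := by rw [bw0]; exact memw 0 (by omega)
  have mV : ∀ W, tw Q W ∈ ℬ → W.card ≤ (symmDiff (posF (v p)) Q).card := by
    intro W hW
    have := hvmax.2 _ hW
    rwa [height_tw, hgt _ (memv p le_rfl)] at this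
  have mW : ∀ W, tw Q W ∈ ℬ → W.card ≤ (symmDiff (posF (w q)) Q).card := by
    intro W hW
    have := hwmax.2 _ hW
    rwa [height_tw, hgt _ (memw q le_rfl)] at this
  have dz := DD_max H feV feW mV mW
  have c := coc H fe0 feV feW
  have ec : (symmDiff (posF (v p)) Q).card = (symmDiff (posF (w q)) Q).card :=
    le_antisymm (mW _ feV) (mV _ feW)
  have e0 : v 0 = w 0 := by rw [hv0, hw0]
  rw [e0, ec] at sv
  have fin : (((Finset.range q).filter fun i =>
      s (lag Q) (tw Q (symmDiff (posF (w i)) Q)) ≠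
        s (lag Q) (tw Q (symmDiff (posF (w (i + 1))) Q))).card : ℤ) =
      (((Finset.range p).filter fun i =>
      s (lag Q) (tw Q (symmDiff (posF (v i)) Q)) ≠
        s (lag Q) (tw Q (symmDiff (posF (v (i + 1))) Q))).card : ℤ) := by
    linarith
  have fin2 := Nat.cast_injective fin
  unfold signChanges
  refine Eq.trans ?_ (fin2.trans ?_)
  · congr 1
    refine Finset.filter_congr (fun i hi => ?_)
    rw [Finset.mem_range] at hi
    rw [hB _ (memw i (by omega)), hB _ (memw (i + 1) (by omega))]
  · congr 1
    refine Finset.filter_congr (fun i hi => ?_)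
    rw [Finset.mem_range] at hi
    have := (edge_step hM hs hF (Ev i hi) (Lv i hi)).2
    rw [hB _ (memv i (by omega)), hB _ (memv (i + 1) (by omega))] at this ⊢
    exact this.symm
end

section
/- Let A be a real symmetric n×n matrix. Let ℬ be the collection of subsets K ⊆ {1,…,n} whose principal minor det(A on rows and columns K) is nonzero (with ∅ ∈ ℬ, the empty minor being 1), and let P ⊆ ℝ^n be the convex hull of the points v_K = Σ_{i∈K} e_i − Σ_{i∉K} e_i for K ∈ ℬ, where e_1,…,e_n is the standard basis. Orient each edge of P that is also an edge of the hypercube [−1,1]^n as follows: if its endpoints correspond to K and K ∪ {i} with i ∉ K, direct it from v_K to v_{K∪{i}} when the principal minors on K and on K ∪ {i} have the same sign, and from v_{K∪{i}} to v_K when they have opposite signs; edges of P that are diagonals of 2-dimensional faces of the hypercube remain undirected. Then in every 2-dimensional face of P, the number of directed edges oriented clockwise equals the number oriented anti-clockwise. -/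
open Finset Matrix
open scoped Classical

/-- The vertex `v_K = Σ_{i∈K} e_i − Σ_{i∉K} e_i` of the hypercube `[−1,1]^n`. -/
def cvtx {n : ℕ} (K : Finset (Fin n)) : Fin n → ℝ := fun i => if i ∈ K then 1 else -1

/-- The principal minor of a square matrix on the rows and columns indexed by `K`
(the empty minor being `1`). -/
def pminor {n : ℕ} (M : Matrix (Fin n) (Fin n) ℝ) (K : Finset (Fin n)) : ℝ :=
  (M.submatrix (fun x : {a : Fin n // a ∈ K} => x.1) fun x : {a : Fin n // a ∈ K} => x.1).det

/-- The polytope `P`: the convex hull of the points `v_K`, `K ∈ 𝒱`. -/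
def cubePolytope {n : ℕ} (𝒱 : Finset (Finset (Fin n))) : Set (Fin n → ℝ) :=
  convexHull ℝ (cvtx '' ↑𝒱)

/-- `v_K` and `v_L` are joined by an edge of `P`: some linear functional takes equal
maximal values at them and strictly smaller values at all other vertices of `P`. -/
def CEdge {n : ℕ} (𝒱 : Finset (Finset (Fin n))) (K L : Finset (Fin n)) : Prop :=
  K ∈ 𝒱 ∧ L ∈ 𝒱 ∧ K ≠ L ∧
  ∃ f : (Fin n → ℝ) →ₗ[ℝ] ℝ, f (cvtx K) = f (cvtx L) ∧
    ∀ C ∈ 𝒱, C ≠ K → C ≠ L → f (cvtx C) < f (cvtx K)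

/-- A 2-dimensional (exposed) face of `P`. -/
def C2Face {n : ℕ} (𝒱 : Finset (Finset (Fin n))) (Fc : Set (Fin n → ℝ)) : Prop :=
  IsExposed ℝ (cubePolytope 𝒱) Fc ∧ Module.finrank ℝ (vectorSpan ℝ Fc) = 2

/-- `v 0, …, v (m-1)` is the cycle of vertices of the 2-dimensional face `Fc` of `P`,
consecutive ones (cyclically) being joined by edges of `P`. -/
def CFaceCycle {n : ℕ} (𝒱 : Finset (Finset (Fin n))) (Fc : Set (Fin n → ℝ)) (m : ℕ)
    (v : ℕ → Finset (Fin n)) : Prop :=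
  C2Face 𝒱 Fc ∧ 3 ≤ m ∧ (∀ i < m, v i ∈ 𝒱 ∧ cvtx (v i) ∈ Fc) ∧
  (∀ K ∈ 𝒱, cvtx K ∈ Fc → ∃! i : ℕ, i < m ∧ v i = K) ∧
  ∀ i < m, CEdge 𝒱 (v i) (v ((i + 1) % m))

/-- The direction assigned to the hypercube edges of `P` by the signs of the principal
minors of `A`: for an edge of `P` joining `K` and `K ∪ {i}`, the value is `+1` in the
direction from `K` to `K ∪ {i}` if the two principal minors have the same sign and `−1`
if the signs differ; diagonal (non-hypercube) edges of `P` get the value `0`. -/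
noncomputable def cdir {n : ℕ} (A : Matrix (Fin n) (Fin n) ℝ)
    (𝒱 : Finset (Finset (Fin n))) (K L : Finset (Fin n)) : ℤ :=
  if CEdge 𝒱 K L ∧ ∃ i ∉ K, L = insert i K then
    (if 0 < pminor A K * pminor A L then 1 else -1)
  else if CEdge 𝒱 K L ∧ ∃ i ∉ L, K = insert i L then
    (if 0 < pminor A K * pminor A L then -1 else 1)
  else 0


/-! ### The coordinate swap maps -/

/-- Matrix with the rows of `A` for indices in `K` and rows of the identity otherwise. -/
noncomputable def opMat {n : ℕ} (A : Matrix (Fin n) (Fin n) ℝ) (K : Finset (Fin n)) :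
    Matrix (Fin n) (Fin n) ℝ :=
  Matrix.of fun i j => if i ∈ K then A i j else (1 : Matrix (Fin n) (Fin n) ℝ) i j

lemma opMat_det {n : ℕ} (A : Matrix (Fin n) (Fin n) ℝ) (K : Finset (Fin n)) :
    (opMat A K).det = pminor A K := by
  rw [Matrix.twoBlockTriangular_det (opMat A K) (fun i => i ∈ K)]
  · have h2 : (toSquareBlockProp (opMat A K) fun i => ¬ i ∈ K) = 1 := by
      ext i j
      simp [toSquareBlockProp, opMat, i.2, Matrix.one_apply, Subtype.ext_iff]
    have h1 : (toSquareBlockProp (opMat A K) fun i => i ∈ K) =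
        (A.submatrix (fun x : {a : Fin n // a ∈ K} => x.1)
          fun x : {a : Fin n // a ∈ K} => x.1) := by
      ext i j
      simp [toSquareBlockProp, opMat, i.2]
    rw [h2, h1, Matrix.det_one, mul_one, pminor]
    congr!
  · intro i hi j hj
    have : i ≠ j := by rintro rfl; exact hi hj
    simp [opMat, hi, Matrix.one_apply, this]

lemma opMat_mulVec {n : ℕ} (A : Matrix (Fin n) (Fin n) ℝ) (K : Finset (Fin n))
    (x : Fin n → ℝ) (k : Fin n) :
    (opMat A K *ᵥ x) k = if k ∈ K then (A *ᵥ x) k else x k := by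
  by_cases h : k ∈ K
  · simp [Matrix.mulVec, dotProduct, opMat, h]
  · simp [Matrix.mulVec, dotProduct, opMat, h, Matrix.one_apply]

lemma pminor_ne_zero_iff {n : ℕ} (A : Matrix (Fin n) (Fin n) ℝ) (K : Finset (Fin n)) :
    pminor A K ≠ 0 ↔
      ∀ x : Fin n → ℝ, (∀ k, (if k ∈ K then (A *ᵥ x) k else x k) = 0) → x = 0 := by
  rw [← opMat_det, ne_eq, ← Matrix.exists_mulVec_eq_zero_iff]
  constructor
  · intro h x hx
    by_contra hne
    exact h ⟨x, hne, by ext k; rw [opMat_mulVec]; exact hx k⟩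
  · rintro h ⟨x, hne, hx⟩
    exact hne (h x fun k => by rw [← opMat_mulVec, hx]; rfl)

lemma exists_dual {n : ℕ} {A : Matrix (Fin n) (Fin n) ℝ} {K : Finset (Fin n)}
    (hK : pminor A K ≠ 0) (b : Fin n → ℝ) : ∃ x : Fin n → ℝ, opMat A K *ᵥ x = b := by
  refine ⟨(opMat A K)⁻¹ *ᵥ b, ?_⟩
  rw [Matrix.mulVec_mulVec, Matrix.mul_nonsing_inv, Matrix.one_mulVec]
  rw [opMat_det]; exact isUnit_iff_ne_zero.mpr hK

lemma symm_pairing {n : ℕ} {A : Matrix (Fin n) (Fin n) ℝ} (hA : A.IsSymm) (x y : Fin n → ℝ) :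
    ∑ k, (x k * (A *ᵥ y) k - y k * (A *ᵥ x) k) = 0 := by
  have : x ⬝ᵥ (A *ᵥ y) = y ⬝ᵥ (A *ᵥ x) := by
    rw [Matrix.dotProduct_mulVec, ← Matrix.mulVec_transpose, hA.eq, dotProduct_comm]
  rw [Finset.sum_sub_distrib, sub_eq_zero]
  exact this

lemma pminor_symmDiff_ne_zero_iff {n : ℕ} (A : Matrix (Fin n) (Fin n) ℝ) (K D : Finset (Fin n)) :
    pminor A (symmDiff K D) ≠ 0 ↔
      ∀ x : Fin n → ℝ, (∀ k, k ∈ D → (opMat A Kᶜ *ᵥ x) k = 0) →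
        (∀ k, k ∉ D → (opMat A K *ᵥ x) k = 0) → x = 0 := by
  rw [pminor_ne_zero_iff]
  simp only [opMat_mulVec, Finset.mem_compl, Finset.mem_symmDiff]
  constructor
  · intro h x h1 h2
    refine h x fun k => ?_
    have h1 := h1 k
    have h2 := h2 k
    by_cases hd : k ∈ D
    · have h1 := h1 hd
      by_cases hk : k ∈ K <;> simpa [hk, hd] using h1
    · have h2 := h2 hd
      by_cases hk : k ∈ K <;> simpa [hk, hd] using h2
  · intro h x h1
    refine h x (fun k hd => ?_) (fun k hd => ?_)
    · have h1 := h1 k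
      by_cases hk : k ∈ K <;> simpa [hk, hd] using h1
    · have h1 := h1 k
      by_cases hk : k ∈ K <;> simpa [hk, hd] using h1

lemma symm_pairing_op {n : ℕ} {A : Matrix (Fin n) (Fin n) ℝ} (hA : A.IsSymm)
    (K : Finset (Fin n)) (x y : Fin n → ℝ) :
    ∑ k, (if k ∈ K then (1 : ℝ) else -1) *
      ((opMat A Kᶜ *ᵥ x) k * (opMat A K *ᵥ y) k - (opMat A Kᶜ *ᵥ y) k * (opMat A K *ᵥ x) k) = 0 := by
  rw [← symm_pairing hA x y]
  refine Finset.sum_congr rfl fun k _ => ?_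
  simp only [opMat_mulVec, Finset.mem_compl]
  by_cases hk : k ∈ K
  · simp [hk]
  · simp only [hk, if_false, not_false_eq_true, if_true]; ring

lemma exchange {n : ℕ} {A : Matrix (Fin n) (Fin n) ℝ} (hA : A.IsSymm)
    {K L : Finset (Fin n)} (hK : pminor A K ≠ 0) (hL : pminor A L ≠ 0) {i : Fin n}
    (hi : i ∈ symmDiff K L) :
    ∃ j ∈ symmDiff K L, pminor A (symmDiff K {i, j}) ≠ 0 := by
  have hK' : ∀ x : Fin n → ℝ, (∀ k, (opMat A K *ᵥ x) k = 0) → x = 0 := by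
    simpa only [opMat_mulVec] using (pminor_ne_zero_iff A K).1 hK
  have hL' : pminor A (symmDiff K (symmDiff K L)) ≠ 0 := by
    rwa [symmDiff_symmDiff_cancel_left]
  rw [pminor_symmDiff_ne_zero_iff] at hL'
  choose z hz using fun j : Fin n => exists_dual hK (Pi.single j 1)
  simp only [pminor_symmDiff_ne_zero_iff, Finset.mem_insert, Finset.mem_singleton]
  have hpair := fun i j => symm_pairing_op hA K (z i) (z j)
  generalize opMat A K = T at *
  generalize opMat A Kᶜ = S at *
  have hzne : ∀ j, z j ≠ 0 := by
    intro j h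
    have := congrFun (hz j) j
    simp [h] at this
  obtain ⟨j, hj, hSj⟩ : ∃ j ∈ symmDiff K L, (S *ᵥ z i) j ≠ 0 := by
    by_contra! hcon
    refine hzne i (hL' _ hcon fun k hk => ?_)
    have : k ≠ i := by rintro rfl; exact hk hi
    simp [hz, this]
  by_cases hii : (S *ᵥ z i) i ≠ 0
  · refine ⟨i, hi, fun x hS hT => ?_⟩
    have hxz : x - (T *ᵥ x) i • z i = 0 := by
      apply hK'
      intro k
      rw [Matrix.mulVec_sub, Matrix.mulVec_smul, hz]
      by_cases hki : k = i
      · subst hki; simp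
      · simp [hki, hT k (by simp [hki])]
    have hxz' : x = (T *ᵥ x) i • z i := sub_eq_zero.1 hxz
    have h4 := hS i (by simp)
    generalize (T *ᵥ x) i = c at *
    rw [hxz', Matrix.mulVec_smul, Pi.smul_apply, smul_eq_mul] at h4
    have : c = 0 := by
      rcases mul_eq_zero.1 h4 with h | h
      · exact h
      · exact absurd h hii
    rw [hxz', this, zero_smul]
  · push Not at hii
    have hij : i ≠ j := by rintro rfl; exact hSj hii
    refine ⟨j, hj, fun x hS hT => ?_⟩
    have hxz : x - ((T *ᵥ x) i • z i + (T *ᵥ x) j • z j) = 0 := by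
      apply hK'
      intro k
      rw [Matrix.mulVec_sub, Matrix.mulVec_add, Matrix.mulVec_smul, Matrix.mulVec_smul, hz, hz]
      by_cases hki : k = i
      · subst hki; simp [hij]
      · by_cases hkj : k = j
        · subst hkj; simp [hki]
        · simp [hki, hkj, hT k (by simp [hki, hkj])]
    have hxz' : x = (T *ᵥ x) i • z i + (T *ᵥ x) j • z j := sub_eq_zero.1 hxz
    have e1 := hS i (by simp)
    have e2 := hS j (by simp)
    generalize (T *ᵥ x) i = c at *
    generalize (T *ᵥ x) j = d at *
    rw [hxz', Matrix.mulVec_add, Matrix.mulVec_smul, Matrix.mulVec_smul] at e1 e2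
    simp only [Pi.add_apply, Pi.smul_apply, smul_eq_mul] at e1 e2
    have hne : (S *ᵥ z j) i ≠ 0 := by
      intro h0
      have hs := hpair i j
      rw [Finset.sum_eq_single j] at hs
      · simp only [hz, Pi.single_eq_same, Pi.single_eq_of_ne hij.symm, mul_one, mul_zero,
          sub_zero] at hs
        rcases mul_eq_zero.1 hs with h | h
        · split_ifs at h <;> norm_num at h
        · exact hSj h
      · intro k _ hkj
        by_cases hki : k = i
        · subst hki
          simp [hz, hkj, h0]
        · simp [hz, hkj, hki]
      · simp
    rw [hii, mul_zero, zero_add] at e1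
    have hd0 : d = 0 := by
      rcases mul_eq_zero.1 e1 with h | h
      · exact h
      · exact absurd h hne
    rw [hd0, zero_mul, add_zero] at e2
    have hc0 : c = 0 := by
      rcases mul_eq_zero.1 e2 with h | h
      · exact h
      · exact absurd h hSj
    rw [hxz', hc0, hd0, zero_smul, zero_smul, add_zero]

/-! ### Edges of the polytope -/

lemma cvtx_toggle {n : ℕ} (K : Finset (Fin n)) (i : Fin n) :
    cvtx (symmDiff K {i}) = cvtx K - Pi.single i (2 * cvtx K i) := by
  ext k
  simp only [cvtx, Finset.mem_symmDiff, Finset.mem_singleton, Pi.sub_apply, Pi.single_apply]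
  by_cases hk : k = i
  · subst hk
    by_cases h : k ∈ K <;> simp [h] <;> norm_num
  · by_cases h : k ∈ K <;> simp [h, hk]

lemma symmDiff_pair {n : ℕ} (K : Finset (Fin n)) {i j : Fin n} (hij : i ≠ j) :
    symmDiff K {i, j} = symmDiff (symmDiff K {i}) {j} := by
  ext k
  simp only [Finset.mem_symmDiff, Finset.mem_insert, Finset.mem_singleton]
  grind

lemma cvtx_toggle_other {n : ℕ} (K : Finset (Fin n)) {i j : Fin n} (hij : i ≠ j) :
    cvtx (symmDiff K {i}) j = cvtx K j := by
  rw [cvtx_toggle]; simp [hij.symm]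

lemma cvtx_opp {n : ℕ} {K L : Finset (Fin n)} {i : Fin n} (hi : i ∈ symmDiff K L) :
    cvtx L i = - cvtx K i := by
  rw [Finset.mem_symmDiff] at hi
  simp only [cvtx]
  rcases hi with ⟨h1, h2⟩ | ⟨h1, h2⟩ <;> simp [h1, h2]

lemma edge_card {n : ℕ} {A : Matrix (Fin n) (Fin n) ℝ} (hA : A.IsSymm)
    {𝒱 : Finset (Finset (Fin n))} (h𝒱 : ∀ K : Finset (Fin n), K ∈ 𝒱 ↔ pminor A K ≠ 0)
    {K L : Finset (Fin n)} (h : CEdge 𝒱 K L) : (symmDiff K L).card ≤ 2 := by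
  obtain ⟨hK, hL, hne, f, hf, hmax⟩ := h
  by_contra! hcard
  have hDne : (symmDiff K L).Nonempty := Finset.card_pos.1 (by omega)
  let c : Fin n → ℝ := fun i => f (Pi.single i (2 * cvtx K i))
  obtain ⟨i, hi, himax⟩ := Finset.exists_max_image (symmDiff K L) (fun i => |c i|) hDne
  -- toggled sets are different from `K` and `L`
  have hstrict : ∀ X Y : Finset (Fin n), symmDiff X Y = symmDiff K L → ∀ a b : Fin n,
      symmDiff X {a, b} ≠ X ∧ symmDiff X {a, b} ≠ Y := by
    intro X Y hXY a b
    constructor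
    · intro h
      rw [symmDiff_eq_left] at h
      have : a ∈ ({a, b} : Finset (Fin n)) := by simp
      rw [h] at this
      simp at this
    · intro h
      have h2 : symmDiff X Y = {a, b} := by rw [← h, symmDiff_symmDiff_cancel_left]
      have := Finset.card_le_two (a := a) (b := b)
      rw [← h2, hXY] at this
      omega
  have key : ∀ X Y : Finset (Fin n), symmDiff X Y = symmDiff K L → ∀ a b : Fin n,
      f (cvtx (symmDiff X {a, b})) = f (cvtx X) - f (Pi.single a (2 * cvtx X a))
        - if a = b then 0 else f (Pi.single b (2 * cvtx X b)) := by
    intro X Y hXY a b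
    by_cases hab : a = b
    · subst hab
      simp [cvtx_toggle]
    · rw [symmDiff_pair X hab, cvtx_toggle, cvtx_toggle_other X hab, cvtx_toggle]
      simp [hab]
  have hopp : ∀ a ∈ symmDiff K L, f (Pi.single a (2 * cvtx L a)) = - c a := by
    intro a ha
    rw [cvtx_opp ha, mul_neg, Pi.single_neg, map_neg]
  rcases le_or_gt (c i) 0 with hc | hc
  · obtain ⟨j, hj, hjm⟩ := exchange hA ((h𝒱 K).1 hK) ((h𝒱 L).1 hL) hi
    have h1 := hstrict K L rfl i j
    have h2 := hmax _ ((h𝒱 _).2 hjm) h1.1 h1.2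
    rw [key K L rfl] at h2
    have h3 := himax j hj
    change f (cvtx K) - c i - (if i = j then 0 else c j) < _ at h2
    rw [abs_of_nonpos hc] at h3
    have h4 := le_abs_self (c j)
    split_ifs at h2 <;> linarith
  · have hi' : i ∈ symmDiff L K := by rwa [symmDiff_comm]
    obtain ⟨j, hj, hjm⟩ := exchange hA ((h𝒱 L).1 hL) ((h𝒱 K).1 hK) hi'
    have hj' : j ∈ symmDiff K L := by rwa [symmDiff_comm]
    have h1 := hstrict L K (symmDiff_comm L K) i j
    have h2 := hmax _ ((h𝒱 _).2 hjm) h1.2 h1.1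
    rw [key L K (symmDiff_comm L K), hopp i hi, hopp j hj', hf] at h2
    have h3 := himax j hj'
    have h5 : |c i| = c i := abs_of_pos hc
    have h4 := neg_abs_le (c j)
    simp only [h5] at h3
    split_ifs at h2 <;> linarith

/-! ### Signatures of restrictions of a quadratic form -/

section Sig

variable {E : Type*} [AddCommGroup E] [Module ℝ E] [FiniteDimensional ℝ E]

lemma sig_exists (Q : QuadraticForm ℝ E) (U : Submodule ℝ E) :
    ∃ W : Submodule ℝ E, W ≤ U ∧ Module.finrank ℝ W = sigPos (Q.restrict U) ∧
      ∀ x ∈ W, x ≠ 0 → 0 < Q x := by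
  obtain ⟨V, hV, hpos⟩ := exists_finrank_eq_sigPos_and_posDef (Q.restrict U)
  refine ⟨V.map U.subtype, Submodule.map_subtype_le U V, ?_, ?_⟩
  · rw [← hV]
    exact Submodule.finrank_map_subtype_eq U V
  · rintro x ⟨y, hy, rfl⟩ hne
    have := hpos ⟨y, hy⟩ (by
      intro h
      apply hne
      have : y = 0 := congrArg Subtype.val h
      simp [this])
    simpa using this

lemma sig_le (Q : QuadraticForm ℝ E) {U W : Submodule ℝ E} (hW : W ≤ U)
    (hpos : ∀ x ∈ W, x ≠ 0 → 0 < Q x) : Module.finrank ℝ W ≤ sigPos (Q.restrict U) := by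
  rw [← (Submodule.comapSubtypeEquivOfLe hW).finrank_eq]
  apply le_sigPos_of_posDef
  rintro ⟨⟨x, hxU⟩, hx⟩ hne
  have : x ∈ W := hx
  have := hpos x this (by rintro rfl; exact hne rfl)
  simpa using this

lemma sig_mono (Q : QuadraticForm ℝ E) {U U' : Submodule ℝ E} (h : U ≤ U') :
    sigPos (Q.restrict U) ≤ sigPos (Q.restrict U') := by
  obtain ⟨W, hW, hr, hpos⟩ := sig_exists Q U
  rw [← hr]
  exact sig_le Q (hW.trans h) hpos

lemma sig_step (Q : QuadraticForm ℝ E) {U U' : Submodule ℝ E} (φ : E →ₗ[ℝ] ℝ)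
    (h : ∀ x ∈ U', φ x = 0 → x ∈ U) :
    sigPos (Q.restrict U') ≤ sigPos (Q.restrict U) + 1 := by
  obtain ⟨W, hW, hr, hpos⟩ := sig_exists Q U'
  rw [← hr]
  have h1 : Module.finrank ℝ (W ⊓ LinearMap.ker φ : Submodule ℝ E) ≤ sigPos (Q.restrict U) := by
    refine sig_le Q (fun x hx => h x (hW hx.1) hx.2) fun x hx => hpos x hx.1
  have h2 := Submodule.finrank_sup_add_finrank_inf_eq W (LinearMap.ker φ)
  have h3 := Submodule.finrank_le (W ⊔ LinearMap.ker φ)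
  have h4 := LinearMap.finrank_range_add_finrank_ker φ
  have h5 := Submodule.finrank_le (LinearMap.range φ)
  rw [Module.finrank_self] at h5
  omega

lemma sig_extend (Q : QuadraticForm ℝ E) {U U' : Submodule ℝ E} (hU : U ≤ U') {x : E}
    (hx : x ∈ U') (horth : ∀ u ∈ U, QuadraticMap.polar Q x u = 0) (hQ : 0 < Q x) :
    sigPos (Q.restrict U) + 1 ≤ sigPos (Q.restrict U') := by
  obtain ⟨W, hW, hr, hpos⟩ := sig_exists Q U
  have hx0 : x ≠ 0 := by rintro rfl; simp at hQ
  have hxU : x ∉ U := by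
    intro h
    have h1 := horth x h
    rw [QuadraticMap.polar_self] at h1
    simp only [nsmul_eq_mul] at h1
    norm_num at h1
    linarith
  have hdisj : Disjoint W (Submodule.span ℝ {x}) := by
    rw [Submodule.disjoint_span_singleton]
    intro h
    exact absurd (hW h) hxU
  have h2 := Submodule.finrank_sup_add_finrank_inf_eq W (Submodule.span ℝ {x})
  rw [hdisj.eq_bot, finrank_bot, finrank_span_singleton hx0] at h2
  rw [← hr]
  have h3 : Module.finrank ℝ (W ⊔ Submodule.span ℝ {x} : Submodule ℝ E) ≤
      sigPos (Q.restrict U') := by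
    refine sig_le Q (sup_le (hW.trans hU) ?_) ?_
    · rw [Submodule.span_singleton_le_iff_mem]; exact hx
    · intro y hy hne
      obtain ⟨w, hw, s, hs, rfl⟩ := Submodule.mem_sup.1 hy
      obtain ⟨c, rfl⟩ := Submodule.mem_span_singleton.1 hs
      have h4 : QuadraticMap.polar Q w (c • x) = 0 := by
        rw [QuadraticMap.polar_smul_right, QuadraticMap.polar_comm, horth w (hW hw), smul_zero]
      have h5 : Q (w + c • x) = Q w + c * c * Q x := by
        rw [QuadraticMap.map_add Q, h4, QuadraticMap.map_smul, smul_eq_mul, add_zero]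
      rw [h5]
      by_cases hw0 : w = 0
      · subst hw0
        have hc : c ≠ 0 := by rintro rfl; simp at hne
        have : 0 < c * c := mul_self_pos.2 hc
        simp only [QuadraticMap.map_zero, zero_add]
        positivity
      · have := hpos w hw hw0
        have := mul_self_nonneg c
        positivity
  omega

lemma sig_neg (Q : QuadraticForm ℝ E) (U : Submodule ℝ E) :
    sigPos ((-Q).restrict U) = sigNeg (Q.restrict U) := by
  rw [← sigPos_neg]; rfl

end Sig

/-! ### The potential -/

/-- The quadratic form of `A`. -/
noncomputable def qf {n : ℕ} (A : Matrix (Fin n) (Fin n) ℝ) : QuadraticForm ℝ (Fin n → ℝ) :=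
  LinearMap.BilinMap.toQuadraticMap (Matrix.toLinearMap₂' ℝ A)

/-- Vectors supported on `K`. -/
def suppOn {n : ℕ} (K : Finset (Fin n)) : Submodule ℝ (Fin n → ℝ) where
  carrier := {x | ∀ k, k ∉ K → x k = 0}
  add_mem' := by
    intro a b ha hb k hk
    simp [ha k hk, hb k hk]
  zero_mem' := by intro k _; rfl
  smul_mem' := by
    intro c a ha k hk
    simp [ha k hk]

lemma mem_suppOn {n : ℕ} {K : Finset (Fin n)} {x : Fin n → ℝ} :
    x ∈ suppOn K ↔ ∀ k, k ∉ K → x k = 0 := Iff.rfl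

lemma finrank_suppOn {n : ℕ} (K : Finset (Fin n)) : Module.finrank ℝ (suppOn K) = K.card := by
  have h : suppOn K = Pi.spanSubset ℝ (K : Set (Fin n)) := by
    ext x
    rw [Pi.mem_spanSubset_iff]
    simp [mem_suppOn]
  rw [h, Pi.dim_spanSubset]
  simp

lemma qf_apply {n : ℕ} (A : Matrix (Fin n) (Fin n) ℝ) (x : Fin n → ℝ) :
    qf A x = x ⬝ᵥ (A *ᵥ x) := by
  simp [qf, Matrix.toLinearMap₂'_apply']

lemma qf_polar {n : ℕ} {A : Matrix (Fin n) (Fin n) ℝ} (hA : A.IsSymm) (x y : Fin n → ℝ) :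
    QuadraticMap.polar (qf A) x y = 2 * ((A *ᵥ x) ⬝ᵥ y) := by
  have : x ⬝ᵥ (A *ᵥ y) = y ⬝ᵥ (A *ᵥ x) := by
    rw [Matrix.dotProduct_mulVec, ← Matrix.mulVec_transpose, hA.eq, dotProduct_comm]
  simp only [QuadraticMap.polar, qf_apply, Matrix.mulVec_add, add_dotProduct, dotProduct_add]
  rw [this, dotProduct_comm (A *ᵥ x) y]
  ring

lemma dot_suppOn {n : ℕ} {K : Finset (Fin n)} {u v : Fin n → ℝ}
    (hu : ∀ k ∈ K, u k = 0) (hv : v ∈ suppOn K) : u ⬝ᵥ v = 0 := by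
  refine Finset.sum_eq_zero fun k _ => ?_
  by_cases hk : k ∈ K
  · rw [hu k hk, zero_mul]
  · rw [hv k hk, mul_zero]

/-- `pminor` is nonzero iff the radical vanishes. -/
lemma pminor_iff_radical {n : ℕ} {A : Matrix (Fin n) (Fin n) ℝ} (hA : A.IsSymm)
    (K : Finset (Fin n)) :
    pminor A K ≠ 0 ↔ Module.finrank ℝ ((qf A).restrict (suppOn K)).radical = 0 := by
  rw [Submodule.finrank_eq_zero, pminor_ne_zero_iff, QuadraticMap.radical_eq_ker_polarBilin,
    Submodule.eq_bot_iff]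
  have hpol : ∀ a b : suppOn K, QuadraticMap.polar ((qf A).restrict (suppOn K)) a b =
      2 * ((A *ᵥ a.1) ⬝ᵥ b.1) := fun a b => by
    rw [← qf_polar hA]; rfl
  constructor
  · rintro h ⟨x, hx⟩ hker
    have hx0 : x = 0 := by
      apply h
      intro k
      split_ifs with hk
      · have hs : (Pi.single k 1 : Fin n → ℝ) ∈ suppOn K := by
          intro l hl
          have : l ≠ k := by rintro rfl; exact hl hk
          simp [this]
        have h1 := LinearMap.congr_fun (LinearMap.mem_ker.1 hker) ⟨_, hs⟩
        rw [QuadraticMap.polarBilin_apply_apply, hpol] at h1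
        simpa using h1
      · exact hx k hk
    subst hx0; rfl
  · intro h x hx
    have hxs : x ∈ suppOn K := by
      intro k hk
      have := hx k
      rwa [if_neg hk] at this
    have := h ⟨x, hxs⟩ (by
      rw [LinearMap.mem_ker]
      ext b
      rw [QuadraticMap.polarBilin_apply_apply, hpol,
        dot_suppOn (K := K) (fun k hk => by have := hx k; rwa [if_pos hk] at this) b.2]
      simp)
    exact congrArg Subtype.val this

/-- Signature of the principal submatrix on `K`. -/
noncomputable def pot {n : ℕ} (A : Matrix (Fin n) (Fin n) ℝ) (K : Finset (Fin n)) : ℤ :=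
  (sigPos ((qf A).restrict (suppOn K)) : ℤ) - sigNeg ((qf A).restrict (suppOn K))

lemma suppOn_mono {n : ℕ} {K : Finset (Fin n)} (i : Fin n) : suppOn K ≤ suppOn (insert i K) := by
  intro x hx k hk
  exact hx k (fun h => hk (Finset.mem_insert_of_mem h))

lemma sig_bounds {n : ℕ} (Q : QuadraticForm ℝ (Fin n → ℝ)) (K : Finset (Fin n)) (i : Fin n) :
    sigPos (Q.restrict (suppOn K)) ≤ sigPos (Q.restrict (suppOn (insert i K))) ∧
    sigPos (Q.restrict (suppOn (insert i K))) ≤ sigPos (Q.restrict (suppOn K)) + 1 := by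
  refine ⟨sig_mono Q (suppOn_mono i), sig_step Q (LinearMap.proj i) ?_⟩
  intro x hx h0 k hk
  by_cases hki : k = i
  · subst hki; exact h0
  · exact hx k (by simp [hki, hk])

lemma sig_total {n : ℕ} (A : Matrix (Fin n) (Fin n) ℝ) (K : Finset (Fin n)) :
    sigPos ((qf A).restrict (suppOn K)) + sigNeg ((qf A).restrict (suppOn K)) +
      Module.finrank ℝ ((qf A).restrict (suppOn K)).radical = K.card := by
  rw [QuadraticForm.sigPos_add_sigNeg_add_radical, finrank_suppOn]

lemma pot_eq {n : ℕ} {A : Matrix (Fin n) (Fin n) ℝ} (hA : A.IsSymm) {K : Finset (Fin n)}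
    {i : Fin n} (hi : i ∉ K) (h : ¬ (pminor A K ≠ 0 ↔ pminor A (insert i K) ≠ 0)) :
    pot A (insert i K) = pot A K := by
  have hp := sig_bounds (qf A) K i
  have hn := sig_bounds (-qf A) K i
  rw [sig_neg, sig_neg] at hn
  have t1 := sig_total A K
  have t2 := sig_total A (insert i K)
  rw [Finset.card_insert_of_notMem hi] at t2
  rw [pminor_iff_radical hA, pminor_iff_radical hA] at h
  unfold pot
  omega

lemma schur {n : ℕ} {A : Matrix (Fin n) (Fin n) ℝ} {K : Finset (Fin n)} {i : Fin n}
    (hi : i ∉ K) (hK : pminor A K ≠ 0) :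
    ∃ x : Fin n → ℝ, x ∈ suppOn (insert i K) ∧ (∀ k ∈ K, (A *ᵥ x) k = 0) ∧
      pminor A (insert i K) = pminor A K * qf A x := by
  obtain ⟨x, hx⟩ := exists_dual hK (Pi.single i 1)
  have hx' : ∀ k, (if k ∈ K then (A *ᵥ x) k else x k) = if k = i then 1 else 0 := by
    intro k
    rw [← opMat_mulVec, hx, Pi.single_apply]
  have h1 : ∀ k ∈ K, (A *ᵥ x) k = 0 := by
    intro k hk
    have := hx' k
    rwa [if_pos hk, if_neg (by rintro rfl; exact hi hk)] at this
  have h2 : x ∈ suppOn (insert i K) := by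
    intro k hk
    simp only [Finset.mem_insert, not_or] at hk
    have := hx' k
    rwa [if_neg hk.2, if_neg hk.1] at this
  have h3 : x i = 1 := by
    have := hx' i
    rwa [if_neg hi, if_pos rfl] at this
  refine ⟨x, h2, h1, ?_⟩
  have hq : qf A x = A i ⬝ᵥ x := by
    rw [qf_apply, dotProduct, Finset.sum_eq_single i]
    · rw [h3, one_mul]; rfl
    · intro k _ hki
      by_cases hk : k ∈ K
      · rw [h1 k hk, mul_zero]
      · rw [h2 k (by simp [hki, hk]), zero_mul]
    · simp
  have hup : opMat A (insert i K) = (opMat A K).updateRow i (A i) := by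
    ext a b
    by_cases ha : a = i
    · subst ha; simp [opMat]
    · simp [opMat, ha]
  rw [← opMat_det, ← opMat_det, hq, hup, ← Matrix.cramer_transpose_apply,
    Matrix.cramer_eq_adjugate_mulVec, ← Matrix.adjugate_transpose, Matrix.mulVec_transpose]
  have hadj : (opMat A K).adjugate *ᵥ (Pi.single i 1) = (opMat A K).det • x := by
    rw [← hx, Matrix.mulVec_mulVec, Matrix.adjugate_mul, Matrix.smul_mulVec, Matrix.one_mulVec]
  have : (A i ᵥ* (opMat A K).adjugate) i = (A i ᵥ* (opMat A K).adjugate) ⬝ᵥ Pi.single i 1 := by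
    simp
  rw [this, ← Matrix.dotProduct_mulVec, hadj, dotProduct_smul, smul_eq_mul]

lemma pot_diff {n : ℕ} {A : Matrix (Fin n) (Fin n) ℝ} (hA : A.IsSymm) {K : Finset (Fin n)}
    {i : Fin n} (hi : i ∉ K) (hK : pminor A K ≠ 0) (hK' : pminor A (insert i K) ≠ 0) :
    pot A (insert i K) - pot A K =
      if 0 < pminor A K * pminor A (insert i K) then 1 else -1 := by
  have hp := sig_bounds (qf A) K i
  have hn := sig_bounds (-qf A) K i
  have t1 := sig_total A K
  have t2 := sig_total A (insert i K)
  rw [Finset.card_insert_of_notMem hi] at t2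
  rw [(pminor_iff_radical hA K).1 hK] at t1
  rw [(pminor_iff_radical hA _).1 hK'] at t2
  obtain ⟨x, hxs, hx, hdet⟩ := schur hi hK
  have horth : ∀ u ∈ suppOn K, QuadraticMap.polar (qf A) x u = 0 := by
    intro u hu
    rw [qf_polar hA, dot_suppOn hx hu, mul_zero]
  have hprod : pminor A K * pminor A (insert i K) = pminor A K ^ 2 * qf A x := by
    rw [hdet]; ring
  have hsq : 0 < pminor A K ^ 2 := by positivity
  have hQ0 : qf A x ≠ 0 := by
    intro h0
    rw [h0, mul_zero] at hdet
    exact hK' hdet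
  simp only [hprod, mul_pos_iff_of_pos_left hsq]
  unfold pot
  rcases lt_or_gt_of_ne hQ0 with hneg | hpos
  · have h1 := sig_extend (-qf A) (suppOn_mono i) hxs
      (fun u hu => by
        have := horth u hu
        rw [QuadraticMap.coeFn_neg, QuadraticMap.polar_neg, this, neg_zero])
      (by simpa using hneg)
    rw [sig_neg, sig_neg] at hn h1
    rw [if_neg (not_lt.2 hneg.le)]
    omega
  · have h1 := sig_extend (qf A) (suppOn_mono i) hxs horth hpos
    rw [sig_neg, sig_neg] at hn
    rw [if_pos hpos]
    omega

lemma pot_toggle {n : ℕ} {A : Matrix (Fin n) (Fin n) ℝ} (hA : A.IsSymm) {K : Finset (Fin n)}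
    {i : Fin n} (h1 : pminor A K ≠ 0) (h2 : pminor A (symmDiff K {i}) = 0) :
    pot A (symmDiff K {i}) = pot A K := by
  by_cases hi : i ∈ K
  · have he : insert i (symmDiff K {i}) = K := by
      ext k
      simp only [Finset.mem_insert, Finset.mem_symmDiff, Finset.mem_singleton]
      grind
    have hni : i ∉ symmDiff K {i} := by simp [Finset.mem_symmDiff, hi]
    have := pot_eq hA hni (by rw [he]; simp [h1, h2])
    rw [he] at this
    exact this.symm
  · have he : symmDiff K {i} = insert i K := by
      ext k
      simp only [Finset.mem_insert, Finset.mem_symmDiff, Finset.mem_singleton]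
      grind
    rw [he] at h2 ⊢
    exact pot_eq hA hi (by simp [h1, h2])

lemma cdir_eq {n : ℕ} {A : Matrix (Fin n) (Fin n) ℝ} (hA : A.IsSymm)
    {𝒱 : Finset (Finset (Fin n))} (h𝒱 : ∀ K : Finset (Fin n), K ∈ 𝒱 ↔ pminor A K ≠ 0)
    {K L : Finset (Fin n)} (h : CEdge 𝒱 K L) : cdir A 𝒱 K L = pot A L - pot A K := by
  have hK : pminor A K ≠ 0 := (h𝒱 K).1 h.1
  have hL : pminor A L ≠ 0 := (h𝒱 L).1 h.2.1
  unfold cdir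
  by_cases c1 : ∃ i ∉ K, L = insert i K
  · rw [if_pos ⟨h, c1⟩]
    obtain ⟨i, hi, rfl⟩ := c1
    rw [pot_diff hA hi hK hL]
  · rw [if_neg (fun hh => c1 hh.2)]
    by_cases c2 : ∃ i ∉ L, K = insert i L
    · rw [if_pos ⟨h, c2⟩]
      obtain ⟨i, hi, rfl⟩ := c2
      have := pot_diff hA hi hL hK
      rw [mul_comm] at this
      split_ifs at this ⊢ <;> omega
    · rw [if_neg (fun hh => c2 hh.2)]
      have hcard := edge_card hA h𝒱 h
      have hLD : symmDiff K (symmDiff K L) = L := symmDiff_symmDiff_cancel_left K L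
      generalize symmDiff K L = D at *
      subst hLD
      have hc : D.card = 0 ∨ D.card = 1 ∨ D.card = 2 := by omega
      rcases hc with hc | hc | hc
      · rw [Finset.card_eq_zero] at hc
        subst hc
        exfalso
        apply h.2.2.1
        ext k; simp [Finset.mem_symmDiff]
      · obtain ⟨i, rfl⟩ := Finset.card_eq_one.1 hc
        exfalso
        by_cases hi : i ∈ K
        · refine c2 ⟨i, by simp [Finset.mem_symmDiff, hi], ?_⟩
          ext k
          simp only [Finset.mem_insert, Finset.mem_symmDiff, Finset.mem_singleton]
          grind
        · refine c1 ⟨i, hi, ?_⟩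
          ext k
          simp only [Finset.mem_insert, Finset.mem_symmDiff, Finset.mem_singleton]
          grind
      · obtain ⟨i, j, hij, rfl⟩ := Finset.card_eq_two.1 hc
        -- it is enough to find a singular neighbour
        have main : ∀ a b : Fin n, a ≠ b → ({a, b} : Finset (Fin n)) = {i, j} →
            pminor A (symmDiff K {a}) = 0 →
            (0 : ℤ) = pot A (symmDiff K {i, j}) - pot A K := by
          intro a b hab hset h0
          have e1 := pot_toggle hA hK h0
          have hb : symmDiff (symmDiff K {i, j}) {b} = symmDiff K {a} := by
            rw [← hset, symmDiff_pair K hab, symmDiff_symmDiff_cancel_right]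
          have e2 := pot_toggle hA hL (i := b) (by rw [hb]; exact h0)
          rw [hb] at e2
          omega
        by_cases hi0 : pminor A (symmDiff K {i}) = 0
        · exact main i j hij rfl hi0
        · by_cases hj0 : pminor A (symmDiff K {j}) = 0
          · exact main j i hij.symm (Finset.pair_comm j i) hj0
          · exfalso
            obtain ⟨-, -, -, f, hf, hmax⟩ := h
            have hne : ∀ a, symmDiff K {a} ≠ K := by
              intro a hh
              rw [symmDiff_eq_left] at hh
              simp at hh
            have hne' : ∀ a, symmDiff K {a} ≠ symmDiff K {i, j} := by
              intro a hh
              have h2 := symmDiff_right_injective K hh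
              have := congrArg Finset.card h2
              rw [hc] at this
              simp at this
            have m1 := hmax _ ((h𝒱 _).2 hi0) (hne i) (hne' i)
            have m2 := hmax _ ((h𝒱 _).2 hj0) (hne j) (hne' j)
            rw [symmDiff_pair K hij, cvtx_toggle, cvtx_toggle_other K hij, cvtx_toggle] at hf
            rw [cvtx_toggle] at m1 m2
            simp only [map_sub] at hf m1 m2
            linarith

/-- For a real symmetric matrix `A`, let `P` be the convex hull of
the hypercube vertices `v_K` over the sets `K` with nonzero principal minor, with
hypercube edges of `P` directed according to the signs of the principal minors.  Then
in every 2-dimensional face of `P` the number of directed edges oriented clockwise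
equals the number oriented anti-clockwise. -/
theorem oriented_polytope_of_symmetric_matrix {n : ℕ}
    (A : Matrix (Fin n) (Fin n) ℝ) (hA : A.IsSymm)
    (𝒱 : Finset (Finset (Fin n)))
    (h𝒱 : ∀ K : Finset (Fin n), K ∈ 𝒱 ↔ pminor A K ≠ 0) :
    ∀ (Fc : Set (Fin n → ℝ)) (m : ℕ) (v : ℕ → Finset (Fin n)), CFaceCycle 𝒱 Fc m v →
      (∑ i ∈ Finset.range m, cdir A 𝒱 (v i) (v ((i + 1) % m))) = 0 := by
  intro Fc m v hcyc
  obtain ⟨-, hm, -, -, hedge⟩ := hcyc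
  have h1 : ∀ i ∈ Finset.range m, cdir A 𝒱 (v i) (v ((i + 1) % m)) =
      pot A (v ((i + 1) % m)) - pot A (v (i % m)) := by
    intro i hi
    rw [Finset.mem_range] at hi
    rw [cdir_eq hA h𝒱 (hedge i hi), Nat.mod_eq_of_lt hi]
  rw [Finset.sum_congr rfl h1, Finset.sum_range_sub (fun i => pot A (v (i % m)))]
  simp
end
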